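/- arXiv:1903.07229 — 4 statements merged into one kernel-verified Lean document; each statement's English description precedes it below -/
import Mathlib

section
/- For nonnegative integers k ≤ n, the number of involutions σ of the set {1,…,2n} that commute with the reflection w(i) = 2n+1−i (i.e. σ(2n+1−i) = 2n+1−σ(i) for all i) and have exactly k two-cycles equals C(n,k)·a_k. -/
/-- `a_k := Σ_{b=0}^{⌊k/2⌋} C(k,2b)·(2b)!/b!` (the division is exact). -/
def aseq (k : ℕ) : ℕ :=
  ∑ b ∈ Finset.range (k / 2 + 1),
    Nat.choose k (2 * b) * (Nat.factorial (2 * b) / Nat.factorial b)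

instance decInvolutive (n : ℕ) (f : Equiv.Perm (Fin n)) : Decidable (Function.Involutive f) :=
  inferInstanceAs (Decidable (∀ x, f (f x) = x))

def blockEquiv (n : ℕ) : Fin n × Bool ≃ Fin (2*n) where
  toFun p := if p.2 then Fin.rev ⟨p.1, by omega⟩ else ⟨p.1, by omega⟩
  invFun i := if h : i.val < n then (⟨i, h⟩, false) else (⟨i.rev, by simp [Fin.rev]; omega⟩, true)
  left_inv := by
    rintro ⟨a, _|_⟩
    · simp
    · have := a.2
      have h : ¬ (2 * n - (a.val + 1) < n) := by omega
      simp only [Fin.rev, if_true, h, dite_false, Prod.mk.injEq, and_true]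
      ext; simp only; omega
  right_inv := by
    intro i
    by_cases h : i.val < n
    · simp [h]
    · simp only [h, dite_false, if_true]
      ext; simp only [Fin.val_rev]; omega

theorem blockEquiv_not (n : ℕ) (p : Fin n × Bool) : blockEquiv n (p.1, !p.2) = (blockEquiv n p).rev := by
  obtain ⟨a, _|_⟩ := p <;> simp [blockEquiv]

def SFin (n k : ℕ) (f : Equiv.Perm (Fin n)) : Finset (Fin n → Bool) :=
  Finset.univ.filter fun s => (∀ a, s (f a) = s a) ∧ (Finset.univ.filter (fun a => f a ≠ a ∨ s a = true)).card = k

theorem step1 (n k : ℕ) : Nat.card {σ : Equiv.Perm (Fin (2 * n)) //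
      Function.Involutive σ ∧
      (∀ i, σ (Fin.rev i) = Fin.rev (σ i)) ∧
      (Finset.univ.filter (fun i => σ i ≠ i)).card = 2 * k} =
   Nat.card {σ : Equiv.Perm (Fin n × Bool) //
      Function.Involutive σ ∧
      (∀ p : Fin n × Bool, σ (p.1, !p.2) = ((σ p).1, !(σ p).2)) ∧
      (Finset.univ.filter (fun i => σ i ≠ i)).card = 2 * k} := by
  symm
  refine Nat.card_congr (Equiv.subtypeEquiv (Equiv.permCongr (blockEquiv n)) ?_)
  intro σ
  refine and_congr ?_ (and_congr ?_ ?_)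
  · constructor
    · intro h i
      simp [h _]
    · intro h p
      have := h (blockEquiv n p)
      simpa using this
  · constructor
    · intro h i
      obtain ⟨p, rfl⟩ := (blockEquiv n).surjective i
      rw [← blockEquiv_not]
      simp only [Equiv.permCongr_apply, Equiv.symm_apply_apply, h]
      exact blockEquiv_not n (σ p)
    · intro h p
      have := h (blockEquiv n p)
      rw [← blockEquiv_not] at this
      simp only [Equiv.permCongr_apply, Equiv.symm_apply_apply, ← blockEquiv_not] at this
      exact (blockEquiv n).injective this
  · have : (Finset.univ.filter (fun i => (blockEquiv n).permCongr σ i ≠ i)) = (Finset.univ.filter (fun i => σ i ≠ i)).map (blockEquiv n).toEmbedding := by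
      ext i
      obtain ⟨p, rfl⟩ := (blockEquiv n).surjective i
      rw [Finset.mem_filter, Finset.mem_map_equiv, Finset.mem_filter]
      simp only [Finset.mem_univ, true_and,
        Equiv.permCongr_apply, Equiv.symm_apply_apply, ne_eq, EmbeddingLike.apply_eq_iff_eq]
    rw [this, Finset.card_map]

theorem cardaux (n : ℕ) (f : Fin n → Fin n) (s : Fin n → Bool) (σ : Fin n × Bool → Fin n × Bool)
    (h : ∀ p, σ p = (f p.1, xor p.2 (s p.1))) :
    (Finset.univ.filter (fun i => σ i ≠ i)).card = 2 * (Finset.univ.filter (fun a => f a ≠ a ∨ s a = true)).card := by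
  have : (Finset.univ.filter (fun i => σ i ≠ i)) = (Finset.univ.filter (fun a => f a ≠ a ∨ s a = true)) ×ˢ (Finset.univ : Finset Bool) := by
    ext ⟨a, c⟩
    simp only [h, Finset.mem_filter, Finset.mem_univ, true_and, Finset.mem_product, and_true, ne_eq, Prod.mk.injEq]
    cases c <;> cases s a <;> simp
  rw [this, Finset.card_product]
  simp [mul_comm]

theorem sigma_ext_aux (n k : ℕ)
    (x y : Σ f : {f : Equiv.Perm (Fin n) // Function.Involutive f}, SFin n k f.1)
    (h1 : x.1.1 = y.1.1) (h2 : x.2.1 = y.2.1) : x = y := by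
  obtain ⟨⟨f, hf⟩, ⟨s, hs⟩⟩ := x
  obtain ⟨⟨g, hg⟩, ⟨t, ht⟩⟩ := y
  obtain rfl : f = g := h1
  obtain rfl : s = t := h2
  rfl

def step2equiv (n k : ℕ) : {σ : Equiv.Perm (Fin n × Bool) //
      Function.Involutive σ ∧
      (∀ p : Fin n × Bool, σ (p.1, !p.2) = ((σ p).1, !(σ p).2)) ∧
      (Finset.univ.filter (fun i => σ i ≠ i)).card = 2 * k} ≃
   Σ f : {f : Equiv.Perm (Fin n) // Function.Involutive f}, SFin n k f.1 := by
  have key : ∀ σ : Equiv.Perm (Fin n × Bool), (∀ p : Fin n × Bool, σ (p.1, !p.2) = ((σ p).1, !(σ p).2)) →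
      ∀ p, σ p = ((σ (p.1, false)).1, xor p.2 (σ (p.1, false)).2) := by
    rintro σ h ⟨a, _|_⟩
    · simp
    · have := h (a, false)
      simpa using this
  have inv1 : ∀ σ : Equiv.Perm (Fin n × Bool), Function.Involutive σ →
      (∀ p : Fin n × Bool, σ (p.1, !p.2) = ((σ p).1, !(σ p).2)) →
      Function.Involutive (fun a => (σ (a, false)).1) ∧
      ∀ a, (σ ((σ (a, false)).1, false)).2 = (σ (a, false)).2 := by
    intro σ h1 h2
    have : ∀ a, (σ ((σ (a, false)).1, false)).1 = a ∧ (σ ((σ (a, false)).1, false)).2 = (σ (a, false)).2 := by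
      intro a
      have h3 := h1 (a, false)
      rw [key σ h2 (σ (a, false))] at h3
      simp only [Prod.mk.injEq] at h3
      refine ⟨h3.1, ?_⟩
      have := h3.2
      revert this
      cases (σ ((σ (a, false)).1, false)).2 <;> cases (σ (a, false)).2 <;> simp
    exact ⟨fun a => (this a).1, fun a => (this a).2⟩
  exact {
    toFun := fun σ => ⟨⟨(inv1 σ.1 σ.2.1 σ.2.2.1).1.toPerm, (inv1 σ.1 σ.2.1 σ.2.2.1).1⟩,
      ⟨fun a => (σ.1 (a, false)).2, by
        obtain ⟨σ, h1, h2, h3⟩ := σ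
        simp only [SFin, Finset.mem_filter, Finset.mem_univ, true_and]
        refine ⟨(inv1 σ h1 h2).2, ?_⟩
        rw [cardaux n (fun a => (σ (a, false)).1) (fun a => (σ (a, false)).2) σ (key σ h2)] at h3
        exact Nat.eq_of_mul_eq_mul_left (by norm_num) h3⟩⟩
    invFun := fun x => 
      have hx := (Finset.mem_filter.1 x.2.2).2
      have hi : Function.Involutive (fun p : Fin n × Bool => (x.1.1 p.1, xor p.2 (x.2.1 p.1))) := by
        intro p
        simp [x.1.2 p.1, hx.1]
      ⟨hi.toPerm, hi, by
        intro p
        simp, by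
        exact (cardaux n x.1.1 x.2.1 _ (fun p => rfl)).trans (congrArg (2 * ·) hx.2)⟩
    left_inv := by
      rintro ⟨σ, h1, h2, h3⟩
      apply Subtype.ext
      ext1 p
      exact (key σ h2 p).symm
    right_inv := by
      rintro ⟨⟨f, hf⟩, ⟨s, hs⟩⟩
      apply sigma_ext_aux
      · ext a
        rfl
      · funext a
        exact Bool.false_xor (s a) }

theorem reps_card (n : ℕ) (f : Equiv.Perm (Fin n)) (hf : Function.Involutive f) :
    f.support.card = 2 * (Finset.univ.filter (fun a => a < f a)).card := by
  have h1 : f.support = (Finset.univ.filter (fun a => a < f a)) ∪ (Finset.univ.filter (fun a => a < f a)).map f.toEmbedding := by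
    ext a
    simp only [Equiv.Perm.mem_support, Finset.mem_union, Finset.mem_filter, Finset.mem_univ, true_and, Finset.mem_map_equiv]
    have : f.symm a = f a := by rw [Equiv.symm_apply_eq, hf]
    rw [this, hf]
    grind
  have h2 : Disjoint (Finset.univ.filter (fun a => a < f a)) ((Finset.univ.filter (fun a => a < f a)).map f.toEmbedding) := by
    rw [Finset.disjoint_left]
    intro a
    simp only [Finset.mem_filter, Finset.mem_univ, true_and, Finset.mem_map_equiv]
    have : f.symm a = f a := by rw [Equiv.symm_apply_eq, hf]
    rw [this, hf]
    grind
  rw [h1, Finset.card_union_of_disjoint h2, Finset.card_map]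
  ring

theorem SFin_card (n k b : ℕ) (f : Equiv.Perm (Fin n)) (hf : Function.Involutive f) (hb : f.support.card = 2 * b) :
    (SFin n k f).card = if 2 * b ≤ k then 2 ^ b * Nat.choose (n - 2 * b) (k - 2 * b) else 0 := by
  have hr := reps_card n f hf
  have hcard : ∀ s : Fin n → Bool, (Finset.univ.filter (fun a => f a ≠ a ∨ s a = true)).card
      = 2 * b + (Finset.univ.filter (fun a => f a = a ∧ s a = true)).card := by
    intro s
    rw [← hb, ← Finset.card_union_of_disjoint]
    · congr 1
      ext a
      simp
      tauto
    · rw [Finset.disjoint_left]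
      intro a
      simp
      tauto
  split_ifs with h
  · set R := Finset.univ.filter (fun a => a < f a) with hR
    set F := Finset.univ.filter (fun a => f a = a) with hF
    have hRc : R.card = b := by omega
    have hFc : F.card = n - 2 * b := by
      have : F = f.supportᶜ := by ext a; simp [F]
      rw [this, Finset.card_compl, hb]; simp
    rw [← hRc, ← Finset.card_powerset, hRc, ← hFc, ← Finset.card_powersetCard, ← Finset.card_product]
    refine Finset.card_bij' (fun s _ => (R.filter (fun a => s a = true), F.filter (fun a => s a = true)))
      (fun p _ => fun a => decide (a ∈ p.1 ∨ f a ∈ p.1 ∨ a ∈ p.2)) ?_ ?_ ?_ ?_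
    · intro s hs
      have hs := (Finset.mem_filter.1 hs).2
      rw [hcard] at hs
      simp only [Finset.mem_product, Finset.mem_powerset, Finset.mem_powersetCard]
      refine ⟨Finset.filter_subset _ _, Finset.filter_subset _ _, ?_⟩
      rw [hF, Finset.filter_filter]
      omega
    · rintro ⟨A, B⟩ hp
      simp only [Finset.mem_product, Finset.mem_powerset, Finset.mem_powersetCard] at hp
      obtain ⟨hA, hB, hBc⟩ := hp
      have hA' : ∀ a ∈ A, a < f a := fun a ha => by simpa [R] using hA ha
      have hB' : ∀ a ∈ B, f a = a := fun a ha => by simpa [F] using hB ha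
      simp only [SFin, Finset.mem_filter, Finset.mem_univ, true_and]
      constructor
      · intro a
        have := hf a
        rw [this]
        simp only [decide_eq_decide]
        have := hB' a
        have := hB' (f a)
        grind
      · rw [hcard]
        have : (Finset.univ.filter (fun a => f a = a ∧ decide (a ∈ A ∨ f a ∈ A ∨ a ∈ B) = true)) = B := by
          ext a
          simp only [Finset.mem_filter, Finset.mem_univ, true_and, decide_eq_true_eq]
          have := hA' a
          have := hB' a
          grind
        rw [this]; omega
    · intro s hs
      have hs := (Finset.mem_filter.1 hs).2.1
      funext a
      have h1 := hs a
      have h2 := hf a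
      rw [Bool.eq_iff_iff]
      simp only [R, F, Finset.mem_filter, Finset.mem_univ, true_and, decide_eq_true_eq, h1, h2]
      grind
    · rintro ⟨A, B⟩ hp
      simp only [Finset.mem_product, Finset.mem_powerset, Finset.mem_powersetCard] at hp
      obtain ⟨hA, hB, hBc⟩ := hp
      have hA' : ∀ a ∈ A, a < f a := fun a ha => by simpa [R] using hA ha
      have hB' : ∀ a ∈ B, f a = a := fun a ha => by simpa [F] using hB ha
      simp only [Prod.mk.injEq]
      constructor
      · ext a
        simp only [R, Finset.mem_filter, Finset.mem_univ, true_and, decide_eq_true_eq]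
        have := hA' a
        have := hA' (f a)
        have := hB' a
        have := hf a
        grind
      · ext a
        simp only [F, Finset.mem_filter, Finset.mem_univ, true_and, decide_eq_true_eq]
        have := hA' a
        have := hB' a
        grind
  · rw [Finset.card_eq_zero, SFin, Finset.filter_eq_empty_iff]
    rintro s - ⟨-, h2⟩
    rw [hcard] at h2
    omega

theorem inv_count (n b : ℕ) (h : 2 * b ≤ n) :
    (Finset.univ.filter (fun f : Equiv.Perm (Fin n) => Function.Involutive f ∧ f.support.card = 2 * b)).card
      * 2 ^ b = Nat.choose n (2 * b) * (Nat.factorial (2 * b) / Nat.factorial b) := by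
  have h1 : (Finset.univ.filter (fun f : Equiv.Perm (Fin n) => Function.Involutive f ∧ f.support.card = 2 * b))
      = Finset.univ.filter (fun f : Equiv.Perm (Fin n) => f.cycleType = Multiset.replicate b 2) := by
    ext f
    simp only [Finset.mem_filter, Finset.mem_univ, true_and]
    have hinv : Function.Involutive f ↔ f ^ 2 = 1 := by
      rw [Equiv.ext_iff]
      simp [Function.Involutive, pow_two]
    rw [hinv, ← Equiv.Perm.sum_cycleType]
    constructor
    · rintro ⟨h1, h2⟩
      have h3 := Equiv.Perm.cycleType_of_pow_prime_eq_one h1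
      rw [h3, Multiset.sum_replicate, smul_eq_mul] at h2
      rw [h3]
      congr 1
      omega
    · intro h1
      refine ⟨?_, ?_⟩
      · rw [Equiv.Perm.pow_prime_eq_one_iff, h1]
        intro c hc
        exact Multiset.eq_of_mem_replicate hc
      · rw [h1, Multiset.sum_replicate, smul_eq_mul, mul_comm]
  rw [h1]
  have h2 := Equiv.Perm.card_of_cycleType_mul_eq (Fin n) (Multiset.replicate b 2)
  have h3 : ∏ m ∈ (Multiset.replicate b 2).toFinset, ((Multiset.replicate b 2).count m).factorial = b.factorial := by
    rcases Nat.eq_zero_or_pos b with rfl | hb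
    · simp
    · rw [Multiset.toFinset_replicate, if_neg hb.ne']
      simp
  rw [h3, if_pos ⟨by simp; omega, fun a ha => (Multiset.eq_of_mem_replicate ha).ge⟩] at h2
  simp only [Fintype.card_fin, Multiset.sum_replicate, smul_eq_mul, Multiset.prod_replicate] at h2
  rw [mul_comm b 2] at h2
  have h4 := Nat.choose_mul_factorial_mul_factorial h
  have h5 : Nat.factorial (2 * b) / Nat.factorial b * Nat.factorial b = Nat.factorial (2 * b) :=
    Nat.div_mul_cancel (Nat.factorial_dvd_factorial (by omega))
  have hpos : 0 < (n - 2 * b).factorial * b.factorial := by positivity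
  generalize Nat.factorial (2 * b) / Nat.factorial b = q at h5 ⊢
  apply Nat.eq_of_mul_eq_mul_right hpos
  calc _ = n.factorial := by rw [← h2]; ring
    _ = _ := by rw [← h4, ← h5]; ring

/-- For `k ≤ n`, the number of involutions `σ` of `{1,…,2n}` (here `Fin (2n)`)
commuting with the reflection `w(i) = 2n+1−i` (here `Fin.rev`) and having exactly `k`
two-cycles (i.e. exactly `2k` non-fixed points) equals `C(n,k)·a_k`. -/
theorem stmt1 (n k : ℕ) (hk : k ≤ n) :
    Nat.card {σ : Equiv.Perm (Fin (2 * n)) //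
      Function.Involutive σ ∧
      (∀ i, σ (Fin.rev i) = Fin.rev (σ i)) ∧
      (Finset.univ.filter (fun i => σ i ≠ i)).card = 2 * k} =
    Nat.choose n k * aseq k := by
  rw [step1, Nat.card_congr (step2equiv n k), Nat.card_eq_fintype_card, Fintype.card_sigma]
  simp only [Fintype.card_coe]
  rw [← Finset.sum_subtype (Finset.univ.filter (fun f : Equiv.Perm (Fin n) => Function.Involutive f))
    (fun f => by simp) (fun f => (SFin n k f).card)]
  rw [← Finset.sum_fiberwise_of_maps_to (t := Finset.range (n + 1)) (g := fun f => f.support.card / 2)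
    (fun f _ => by
      have := Finset.card_le_univ f.support
      simp only [Fintype.card_fin] at this
      simp only [Finset.mem_range]
      omega)]
  have key : ∀ b, ∑ f ∈ (Finset.univ.filter (fun f : Equiv.Perm (Fin n) => Function.Involutive f)).filter
      (fun f => f.support.card / 2 = b), (SFin n k f).card =
      if 2 * b ≤ k then Nat.choose n k * (Nat.choose k (2 * b) * (Nat.factorial (2 * b) / Nat.factorial b)) else 0 := by
    intro b
    have h1 : (Finset.univ.filter (fun f : Equiv.Perm (Fin n) => Function.Involutive f)).filter
      (fun f => f.support.card / 2 = b) =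
      Finset.univ.filter (fun f : Equiv.Perm (Fin n) => Function.Involutive f ∧ f.support.card = 2 * b) := by
      ext f
      simp only [Finset.mem_filter, Finset.mem_univ, true_and]
      refine and_congr_right fun hf => ?_
      have := reps_card n f hf
      omega
    rw [h1, Finset.sum_congr rfl (fun f hf => SFin_card n k b f (Finset.mem_filter.1 hf).2.1 (Finset.mem_filter.1 hf).2.2),
      Finset.sum_const, smul_eq_mul]
    split_ifs with h
    · have h2 := inv_count n b (h.trans hk)
      rw [← mul_assoc, h2, ← mul_assoc, Nat.choose_mul h]
      ring
    · simp
  rw [Finset.sum_congr rfl (fun b _ => key b), aseq, Finset.mul_sum, ← Finset.sum_filter]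
  apply Finset.sum_congr _ (fun _ _ => rfl)
  ext b
  simp only [Finset.mem_filter, Finset.mem_range]
  omega
end

section
/- For nonnegative integers k ≤ n, the number ζ_{k,n} of skew-symmetric (n,n)-clans containing exactly k pairs of natural numbers equals 2^{n−k}·C(n,k)·a_k. -/
/-- A skew-symmetric `(n,n)`-clan, encoded (via the standard bijection with signed
involutions) as a pair `(σ, s)` where `σ` is an involution of the `2n` positions whose
2-cycles are the pairs of positions carrying matching natural numbers, and `s` records
the signs at the fixed points (`true` = `+`, `false` = `−`; `s` is normalized to `true`
on non-fixed points).  The conditions say: `σ` is an involution; `s` is normalized;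
there are equally many `+`'s and `−`'s among the sign symbols; and the clan equals its
reverse with all signs interchanged (`Fin.rev` is the reflection `i ↦ 2n+1−i`). -/
def IsSkewClan (n : ℕ) (σ : Equiv.Perm (Fin (2 * n))) (s : Fin (2 * n) → Bool) : Prop :=
  Function.Involutive σ ∧
  (∀ i, σ i ≠ i → s i = true) ∧
  (Finset.univ.filter (fun i => σ i = i ∧ s i = true)).card =
    (Finset.univ.filter (fun i => σ i = i ∧ s i = false)).card ∧
  (∀ i, σ (Fin.rev i) = Fin.rev (σ i)) ∧
  (∀ i, σ i = i → s (Fin.rev i) = !(s i))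

/-- `Z_n`, the number of skew-symmetric `(n,n)`-clans. -/
noncomputable def Znum (n : ℕ) : ℕ :=
  Nat.card {p : Equiv.Perm (Fin (2 * n)) × (Fin (2 * n) → Bool) // IsSkewClan n p.1 p.2}

/-- doubling equivalence -/
def dblEquiv (n : ℕ) : Fin n × Bool ≃ Fin (2 * n) where
  toFun p := if p.2 then Fin.rev ⟨p.1.1, by omega⟩ else ⟨p.1.1, by omega⟩
  invFun i := if h : i.1 < n then (⟨i.1, h⟩, false) else (⟨2 * n - (i.1 + 1), by omega⟩, true)
  left_inv := by
    rintro ⟨⟨a, ha⟩, b⟩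
    cases b
    · simp [ha]
    · have : ¬ (2 * n - (a + 1) < n) := by omega
      simp [Fin.rev, this]
      omega
  right_inv := by
    rintro ⟨i, hi⟩
    by_cases h : i < n
    · simp [h]
    · simp [h, Fin.rev]
      omega

lemma dblEquiv_rev (n : ℕ) (a : Fin n) (b : Bool) :
    Fin.rev (dblEquiv n (a, b)) = dblEquiv n (a, !b) := by
  cases b <;> simp [dblEquiv]

def GoodTriple (n m : ℕ) (τ : Equiv.Perm (Fin n)) (e t : Fin n → Bool) : Prop :=
  Function.Involutive τ ∧ (∀ a, e (τ a) = e a) ∧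
  (∀ a, ¬ (τ a = a ∧ e a = false) → t a = false) ∧
  (Finset.univ.filter (fun a => τ a = a ∧ e a = false)).card = m

/-- clan on the product -/
def PClan (n k : ℕ) (σ : Equiv.Perm (Fin n × Bool)) (s : Fin n × Bool → Bool) : Prop :=
  Function.Involutive σ ∧
  (∀ i, σ i ≠ i → s i = true) ∧
  (∀ a b, σ (a, !b) = ((σ (a, b)).1, !(σ (a,b)).2)) ∧
  (∀ a b, σ (a, b) = (a, b) → s (a, !b) = !(s (a, b))) ∧
  (Finset.univ.filter (fun i => σ i ≠ i)).card = 2 * k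

lemma card_swap {n : ℕ} (P Q : Fin n × Bool → Prop) [DecidablePred P] [DecidablePred Q]
    (h : ∀ a b, P (a, b) ↔ Q (a, !b)) :
    (Finset.univ.filter P).card = (Finset.univ.filter Q).card := by
  refine Finset.card_bij' (fun p _ => (p.1, !p.2)) (fun p _ => (p.1, !p.2)) ?_ ?_ ?_ ?_
  · rintro ⟨a, b⟩ hp
    simpa [h] using hp
  · rintro ⟨a, b⟩ hp
    simpa [h] using hp
  · simp
  · simp

lemma clan_iff (n k : ℕ) (σ : Equiv.Perm (Fin n × Bool)) (s : Fin n × Bool → Bool) :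
    PClan n k σ s ↔ (IsSkewClan n ((dblEquiv n).permCongr σ) (s ∘ (dblEquiv n).symm) ∧
      (Finset.univ.filter (fun i => ((dblEquiv n).permCongr σ) i ≠ i)).card = 2 * k) := by
  have tr : ∀ (P : Fin (2*n) → Prop) [DecidablePred P], (Finset.univ.filter P).card =
      (Finset.univ.filter (fun x => P (dblEquiv n x))).card := by
    intro P _
    rw [← Fintype.card_subtype, ← Fintype.card_subtype]
    exact (Fintype.card_congr ((dblEquiv n).subtypeEquiv (fun a => Iff.rfl))).symm
  unfold PClan IsSkewClan
  simp only [tr]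
  simp only [Function.Involutive, ← (dblEquiv n).forall_congr_right (q := fun i => _ ), Equiv.permCongr_apply,
    Equiv.symm_apply_apply, Prod.forall, dblEquiv_rev, Function.comp, EmbeddingLike.apply_eq_iff_eq, ne_eq]
  have hr : ∀ p : Fin n × Bool, Fin.rev (dblEquiv n p) = dblEquiv n (p.1, !p.2) := fun p =>
    dblEquiv_rev n p.1 p.2
  simp only [hr, EmbeddingLike.apply_eq_iff_eq]
  constructor
  · rintro ⟨h1, h2, h3, h4, h5⟩
    refine ⟨⟨h1, h2, ?_, h3, h4⟩, h5⟩
    apply card_swap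
    intro a b
    constructor
    · rintro ⟨h, h'⟩
      refine ⟨by rw [h3, h], by rw [h4 _ _ h, h']; rfl⟩
    · rintro ⟨h, h'⟩
      have h3' := h3 a (!b)
      have h4' := h4 a (!b) h
      rw [h, Bool.not_not] at h3'
      rw [h', Bool.not_not] at h4'
      exact ⟨h3', by rw [h4']; rfl⟩
  · rintro ⟨⟨h1, h2, -, h3, h4⟩, h5⟩
    exact ⟨h1, h2, h3, h4, h5⟩

lemma card_step1 (n k : ℕ) :
    Nat.card {p : Equiv.Perm (Fin (2 * n)) × (Fin (2 * n) → Bool) //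
      IsSkewClan n p.1 p.2 ∧
      (Finset.univ.filter (fun i => p.1 i ≠ i)).card = 2 * k} =
    Nat.card {p : Equiv.Perm (Fin n × Bool) × (Fin n × Bool → Bool) // PClan n k p.1 p.2} := by
  symm
  refine Nat.card_congr (Equiv.subtypeEquiv
    (Equiv.prodCongr (dblEquiv n).permCongr ((dblEquiv n).arrowCongr (Equiv.refl _))) ?_)
  rintro ⟨σ, s⟩
  exact clan_iff n k σ s

lemma sigma_involutive {n : ℕ} (τ : Equiv.Perm (Fin n)) (e : Fin n → Bool)
    (h1 : Function.Involutive τ) (h2 : ∀ a, e (τ a) = e a) :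
    Function.Involutive (fun p : Fin n × Bool => (τ p.1, xor p.2 (e p.1))) := by
  rintro ⟨a, b⟩
  simp [h1 a, h2]

lemma fix_card {n : ℕ} (Q : Fin n → Prop) [DecidablePred Q] 
    (σ : Equiv.Perm (Fin n × Bool)) (h : ∀ a b, σ (a, b) = (a, b) ↔ Q a) (k : ℕ) (hk : k ≤ n) :
    (Finset.univ.filter (fun i => σ i ≠ i)).card = 2 * k ↔
      (Finset.univ.filter Q).card = n - k := by
  have h1 : (Finset.univ.filter (fun i => σ i ≠ i)) =
      (Finset.univ.filter (fun a => ¬ Q a)) ×ˢ (Finset.univ : Finset Bool) := by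
    ext ⟨a, b⟩
    simp [h]
  have h2 := Finset.card_filter_add_card_filter_not (s := (Finset.univ : Finset (Fin n))) Q
  rw [h1, Finset.card_product]
  simp at h2 ⊢
  omega

lemma sigma_form {n : ℕ} (σ : Equiv.Perm (Fin n × Bool))
    (h3 : ∀ a b, σ (a, !b) = ((σ (a, b)).1, !(σ (a,b)).2)) (a : Fin n) (b : Bool) :
    σ (a, b) = ((σ (a, false)).1, xor b (σ (a, false)).2) := by
  cases b
  · simp
  · simpa using h3 a false

lemma sigma_inv1 {n : ℕ} (σ : Equiv.Perm (Fin n × Bool)) (h1 : Function.Involutive σ)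
    (h3 : ∀ a b, σ (a, !b) = ((σ (a, b)).1, !(σ (a,b)).2)) (a : Fin n) :
    (σ ((σ (a, false)).1, false)).1 = a ∧
    (σ ((σ (a, false)).1, false)).2 = (σ (a, false)).2 := by
  have h := h1 (a, false)
  have h' : σ (a, false) = ((σ (a, false)).1, (σ (a, false)).2) := rfl
  rw [h', sigma_form σ h3] at h
  simp only [Prod.mk.injEq] at h
  refine ⟨h.1, ?_⟩
  have := h.2
  revert this
  generalize (σ (a, false)).2 = x
  generalize (σ ((σ (a, false)).1, false)).2 = y
  cases x <;> cases y <;> simp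

def tripleEquiv (n k : ℕ) (hk : k ≤ n) :
    {p : Equiv.Perm (Fin n × Bool) × (Fin n × Bool → Bool) // PClan n k p.1 p.2} ≃
    {q : Equiv.Perm (Fin n) × (Fin n → Bool) × (Fin n → Bool) //
      GoodTriple n (n - k) q.1 q.2.1 q.2.2} where
  toFun p := ⟨(Function.Involutive.toPerm (fun a => (p.1.1 (a, false)).1)
      (fun a => (sigma_inv1 p.1.1 p.2.1 p.2.2.2.1 a).1),
      fun a => (p.1.1 (a, false)).2,
      fun a => decide (p.1.1 (a, false) = (a, false)) && p.1.2 (a, false)), by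
    obtain ⟨⟨σ, s⟩, h1, h2, h3, h4, h5⟩ := p
    refine ⟨fun a => (sigma_inv1 σ h1 h3 a).1, fun a => (sigma_inv1 σ h1 h3 a).2, ?_, ?_⟩
    · intro a ha
      have : σ (a, false) ≠ (a, false) := by
        intro h
        exact ha ⟨congrArg Prod.fst h, congrArg Prod.snd h⟩
      simp [this]
    · refine (fix_card (fun a => (σ (a, false)).1 = a ∧ (σ (a, false)).2 = false) σ ?_ k hk).1 h5
      intro a b
      rw [sigma_form σ h3 a b]
      cases b <;> cases (σ (a, false)).2 <;> simp⟩
  invFun q := ⟨((sigma_involutive q.1.1 q.1.2.1 q.2.1 q.2.2.1).toPerm _,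
      fun p => if q.1.1 p.1 = p.1 ∧ q.1.2.1 p.1 = false then xor p.2 (q.1.2.2 p.1) else true), by
    obtain ⟨⟨τ, e, t⟩, h1, h2, h3, h4⟩ := q
    refine ⟨sigma_involutive τ e h1 h2, ?_, ?_, ?_, ?_⟩
    · rintro ⟨a, b⟩ h
      change (τ a, xor b (e a)) ≠ (a, b) at h
      refine if_neg ?_
      rintro ⟨h5, h6⟩
      change τ a = a at h5
      change e a = false at h6
      simp [h5, h6] at h
    · rintro a b
      simp
    · rintro a b h
      change (τ a, xor b (e a)) = (a, b) at h
      have hb : e a = false := by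
        have := congrArg Prod.snd h
        revert this
        cases b <;> cases e a <;> simp
      have hc : τ a = a := congrArg Prod.fst h
      simp [hb, hc]
    · refine (fix_card _ _ ?_ k hk).2 h4
      intro a b
      change (τ a, xor b (e a)) = (a, b) ↔ τ a = a ∧ e a = false
      cases b <;> cases e a <;> simp⟩
  left_inv := by
    rintro ⟨⟨σ, s⟩, h1, h2, h3, h4, h5⟩
    refine Subtype.ext (Prod.ext ?_ ?_)
    · ext1 ⟨a, b⟩
      exact (sigma_form σ h3 a b).symm
    · funext ⟨a, b⟩
      change (if (σ (a, false)).1 = a ∧ (σ (a, false)).2 = false then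
        xor b (decide (σ (a, false) = (a, false)) && s (a, false)) else true) = s (a, b)
      split_ifs with h
      · have h' : σ (a, false) = (a, false) := Prod.ext h.1 h.2
        have h6 : s (a, true) = !(s (a, false)) := h4 a false h'
        cases b
        · simp [h']
        · rw [h6]
          simp [h']
      · symm
        apply h2
        rw [sigma_form σ h3 a b]
        intro h'
        apply h
        have h6 := congrArg Prod.fst h'
        have h7 := congrArg Prod.snd h'
        refine ⟨h6, ?_⟩
        revert h7
        cases b <;> cases (σ (a, false)).2 <;> simp
  right_inv := by
    rintro ⟨⟨τ, e, t⟩, h1, h2, h3, h4⟩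
    refine Subtype.ext (Prod.ext ?_ (Prod.ext ?_ ?_))
    · ext1 a
      rfl
    · funext a
      change xor false (e a) = e a
      simp
    · funext a
      change (decide ((τ a, xor false (e a)) = (a, false)) &&
        (if τ a = a ∧ e a = false then xor false (t a) else true)) = t a
      by_cases h : τ a = a ∧ e a = false
      · simp [h]
      · have := h3 a h
        simp_all


lemma card_t {n : ℕ} (Q : Fin n → Prop) [DecidablePred Q] :
    Nat.card {t : Fin n → Bool // ∀ a, ¬ Q a → t a = false} =
      2 ^ (Finset.univ.filter Q).card := by
  have E : {t : Fin n → Bool // ∀ a, ¬ Q a → t a = false} ≃ ({a // Q a} → Bool) :=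
    { toFun := fun t a => t.1 a.1
      invFun := fun f => ⟨fun a => if h : Q a then f ⟨a, h⟩ else false, fun a h => by simp [h]⟩
      left_inv := by
        rintro ⟨t, ht⟩
        apply Subtype.ext
        funext a
        by_cases h : Q a
        · simp [h]
        · simp [h, ht a h]
      right_inv := by
        intro f
        funext ⟨a, h⟩
        simp [h] }
  rw [Nat.card_congr E, Nat.card_eq_fintype_card, Fintype.card_fun, Fintype.card_bool,
    Fintype.card_subtype]

def GoodE (n m : ℕ) (τ : Equiv.Perm (Fin n)) (e : Fin n → Bool) : Prop :=
  (∀ a, e (τ a) = e a) ∧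
  (Finset.univ.filter (fun a => τ a = a ∧ e a = false)).card = m

def eEquiv (n m : ℕ) (τ : Equiv.Perm (Fin n)) (hτ : Function.Involutive τ) :
    {e // GoodE n m τ e} ≃ ({a // a < τ a} → Bool) ×
      {S // S ∈ Finset.powersetCard m (Finset.univ.filter (fun a => τ a = a))} where
  toFun e := (fun a => e.1 a.1, ⟨Finset.univ.filter (fun a => τ a = a ∧ e.1 a = false), by
    rw [Finset.mem_powersetCard]
    refine ⟨?_, e.2.2⟩
    intro a
    simp
    tauto⟩)
  invFun p := ⟨fun a => if h : a < τ a then p.1 ⟨a, h⟩ else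
      if h : τ a < a then p.1 ⟨τ a, by rw [hτ a]; exact h⟩ else decide (a ∉ p.2.1), by
    obtain ⟨f, S, hS⟩ := p
    rw [Finset.mem_powersetCard] at hS
    constructor
    · intro a
      have h' := hτ a
      rcases lt_trichotomy a (τ a) with h | h | h
      · have h2 : ¬ τ a < a := h.not_gt
        simp [h', h, h2]
      · rw [← h]
      · have h2 : ¬ a < τ a := h.not_gt
        simp [h', h, h2]
    · refine Eq.trans (congrArg Finset.card ?_) hS.2
      ext a
      simp only [Finset.mem_filter, Finset.mem_univ, true_and]
      constructor
      · rintro ⟨h1, h2⟩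
        simpa [h1] using h2
      · intro h
        have := hS.1 h
        simp only [Finset.mem_filter, Finset.mem_univ, true_and] at this
        refine ⟨this, ?_⟩
        simp [this, h]⟩
  left_inv := by
    rintro ⟨e, he⟩
    apply Subtype.ext
    funext a
    rcases lt_trichotomy a (τ a) with h | h | h
    · simp [h]
    · have h2 : ¬ a < τ a := by rw [← h]; exact lt_irrefl a
      have h3 : ¬ τ a < a := by rw [← h]; exact lt_irrefl a
      simp [← h]
    · have h2 : ¬ a < τ a := h.not_gt
      simp [h, h2, he.1]
  right_inv := by
    rintro ⟨f, S, hS⟩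
    rw [Finset.mem_powersetCard] at hS
    refine Prod.ext ?_ (Subtype.ext ?_)
    · funext ⟨a, h⟩
      simp [h]
    · ext a
      simp only [Finset.mem_filter, Finset.mem_univ, true_and]
      constructor
      · rintro ⟨h1, h2⟩
        simpa [h1] using h2
      · intro h
        have := hS.1 h
        simp only [Finset.mem_filter, Finset.mem_univ, true_and] at this
        refine ⟨this, ?_⟩
        simp [this, h]

lemma card_lt {n : ℕ} (τ : Equiv.Perm (Fin n)) (hτ : Function.Involutive τ) :
    2 * Fintype.card {a // a < τ a} = τ.support.card := by
  have h1 : (Finset.univ.filter (fun a => a < τ a)).card =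
      (Finset.univ.filter (fun a => τ a < a)).card := by
    refine Finset.card_bij' (fun a _ => τ a) (fun a _ => τ a) ?_ ?_ ?_ ?_
    · intro a; simp [hτ a]
    · intro a; simp [hτ a]
    · intro a; simp [hτ a]
    · intro a; simp [hτ a]
  have h2 : τ.support = (Finset.univ.filter (fun a => a < τ a)) ∪
      (Finset.univ.filter (fun a => τ a < a)) := by
    ext a
    simp only [Equiv.Perm.mem_support, Finset.mem_union, Finset.mem_filter, Finset.mem_univ,
      true_and]
    rw [ne_iff_lt_or_gt, or_comm]
  rw [Fintype.card_subtype, h2, Finset.card_union_of_disjoint, ← h1]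
  · omega
  · rw [Finset.disjoint_filter]
    intro a _ h
    exact h.not_gt

lemma card_fix {n : ℕ} (τ : Equiv.Perm (Fin n)) :
    (Finset.univ.filter (fun a => τ a = a)).card = n - τ.support.card := by
  have h := Finset.card_filter_add_card_filter_not (s := (Finset.univ : Finset (Fin n)))
    (fun a => τ a = a)
  have h2 : τ.support = Finset.univ.filter (fun a => ¬ τ a = a) := by
    ext a
    simp
  rw [h2]
  simp at h ⊢
  omega

lemma card_e (n m : ℕ) (τ : Equiv.Perm (Fin n)) (hτ : Function.Involutive τ) :
    Nat.card {e // GoodE n m τ e} =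
      2 ^ (τ.support.card / 2) * (n - τ.support.card).choose m := by
  rw [Nat.card_congr (eEquiv n m τ hτ), Nat.card_prod, Nat.card_eq_fintype_card,
    Nat.card_eq_fintype_card, Fintype.card_fun, Fintype.card_bool, Fintype.card_coe,
    Finset.card_powersetCard, card_fix, ← card_lt τ hτ]
  simp

def tripleSigma (n m : ℕ) :
    {q : Equiv.Perm (Fin n) × (Fin n → Bool) × (Fin n → Bool) //
      GoodTriple n m q.1 q.2.1 q.2.2} ≃
    Σ τ : {τ : Equiv.Perm (Fin n) // Function.Involutive τ}, Σ e : {e // GoodE n m τ.1 e},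
      {t : Fin n → Bool // ∀ a, ¬ (τ.1 a = a ∧ e.1 a = false) → t a = false} where
  toFun q := ⟨⟨q.1.1, q.2.1⟩, ⟨q.1.2.1, q.2.2.1, q.2.2.2.2⟩, ⟨q.1.2.2, q.2.2.2.1⟩⟩
  invFun x := ⟨(x.1.1, x.2.1.1, x.2.2.1), x.1.2, x.2.1.2.1, x.2.2.2, x.2.1.2.2⟩
  left_inv _ := rfl
  right_inv _ := rfl

open Classical in
lemma card_triple (n m : ℕ) :
    Nat.card {q : Equiv.Perm (Fin n) × (Fin n → Bool) × (Fin n → Bool) //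
      GoodTriple n m q.1 q.2.1 q.2.2} =
    ∑ τ ∈ (Finset.univ.filter (fun τ : Equiv.Perm (Fin n) => Function.Involutive τ)),
      2 ^ (τ.support.card / 2) * (n - τ.support.card).choose m * 2 ^ m := by
  rw [Nat.card_congr (tripleSigma n m), Nat.card_sigma]
  rw [← Finset.sum_subtype_eq_sum_filter, Finset.subtype_univ]
  refine Finset.sum_congr rfl ?_
  rintro ⟨τ, hτ⟩ -
  rw [Nat.card_sigma]
  rw [Finset.sum_congr rfl (g := fun _ => 2 ^ m)]
  · rw [Finset.sum_const, smul_eq_mul, ← card_e n m τ hτ, Nat.card_eq_fintype_card,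
      Finset.card_univ]
  · rintro ⟨e, he⟩ -
    have := card_t (fun a => τ a = a ∧ e a = false)
    rw [he.2] at this
    exact this

lemma invol_cycleType {n : ℕ} (b : ℕ) (τ : Equiv.Perm (Fin n)) :
    (Function.Involutive τ ∧ τ.support.card / 2 = b) ↔ τ.cycleType = Multiset.replicate b 2 := by
  have h0 : Function.Involutive τ ↔ τ ^ 2 = 1 := by
    rw [Equiv.ext_iff]
    simp [Function.Involutive, pow_two]
  have h1 := τ.sum_cycleType
  rw [h0]
  constructor
  · rintro ⟨h2, h3⟩
    have := Equiv.Perm.cycleType_of_pow_prime_eq_one h2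
    rw [this] at h1
    simp at h1
    rw [this, ← h3, ← h1]
    simp
  · intro h
    rw [h] at h1
    simp at h1
    refine ⟨?_, by omega⟩
    rw [Equiv.Perm.pow_prime_eq_one_iff, h]
    intro c hc
    exact Multiset.eq_of_mem_replicate hc

lemma card_cyc (n b : ℕ) (hb : b ≤ n / 2) :
    (Finset.univ.filter (fun τ : Equiv.Perm (Fin n) => τ.cycleType = Multiset.replicate b 2)).card
      * ((n - 2 * b).factorial * 2 ^ b * b.factorial) = n.factorial := by
  have h := Equiv.Perm.card_of_cycleType_mul_eq (α := Fin n) (Multiset.replicate b 2)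
  rw [if_pos] at h
  · simp only [Fintype.card_fin, Multiset.sum_replicate, Multiset.prod_replicate, smul_eq_mul] at h
    rw [← h, mul_comm 2 b]
    congr 2
    rcases Nat.eq_zero_or_pos b with rfl | hb
    · simp
    · rw [Multiset.toFinset_replicate, if_neg hb.ne']
      simp
  · constructor
    · simp
      omega
    · intro a ha
      exact (Multiset.eq_of_mem_replicate ha).ge

lemma arith (n k b N : ℕ) (hk : k ≤ n) (hb : 2 * b ≤ k)
    (hN : N * ((n - 2 * b).factorial * 2 ^ b * b.factorial) = n.factorial) :
    N * (2 ^ b * (n - 2 * b).choose (n - k)) =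
      n.choose k * (k.choose (2 * b) * ((2 * b).factorial / b.factorial)) := by
  obtain ⟨D, hD⟩ := Nat.factorial_dvd_factorial (show b ≤ 2 * b by omega)
  have hD' : (2 * b).factorial / b.factorial = D := by
    rw [hD]; exact Nat.mul_div_cancel_left _ (Nat.factorial_pos b)
  rw [hD']
  have h1 := Nat.choose_mul (n := n) hb
  have h2 := Nat.choose_mul_factorial_mul_factorial (show 2 * b ≤ n by omega)
  have h3 : (n - 2 * b).choose (n - k) = (n - 2 * b).choose (k - 2 * b) := by
    rw [← Nat.choose_symm (show k - 2 * b ≤ n - 2 * b by omega)]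
    congr 1
    omega
  have hpos : 0 < (n - 2 * b).factorial * b.factorial :=
    Nat.mul_pos (Nat.factorial_pos _) (Nat.factorial_pos _)
  apply Nat.eq_of_mul_eq_mul_right hpos
  rw [h3, ← mul_assoc (n.choose k), h1]
  rw [hD] at h2
  calc _ = (N * ((n - 2 * b).factorial * 2 ^ b * b.factorial)) * (n - 2 * b).choose (k - 2 * b) := by
        ring
    _ = (n.choose (2 * b) * (b.factorial * D) * (n - 2 * b).factorial) *
        (n - 2 * b).choose (k - 2 * b) := by rw [hN, h2]
    _ = _ := by ring

/-- the number `ζ_{k,n}` of skew-symmetric `(n,n)`-clans with exactly `k`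
pairs of natural numbers (i.e. `2k` non-fixed positions) equals `2^(n−k)·C(n,k)·a_k`. -/
theorem stmt2 (n k : ℕ) (hk : k ≤ n) :
    Nat.card {p : Equiv.Perm (Fin (2 * n)) × (Fin (2 * n) → Bool) //
      IsSkewClan n p.1 p.2 ∧
      (Finset.univ.filter (fun i => p.1 i ≠ i)).card = 2 * k} =
    2 ^ (n - k) * Nat.choose n k * aseq k := by
  classical
  rw [card_step1, Nat.card_congr (tripleEquiv n k hk), card_triple]
  rw [← Finset.sum_fiberwise_of_maps_to (t := Finset.range (n / 2 + 1))
    (g := fun τ : Equiv.Perm (Fin n) => τ.support.card / 2)]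
  · have key : ∀ b ∈ Finset.range (n / 2 + 1),
        (∑ τ ∈ (Finset.univ.filter
            (fun τ : Equiv.Perm (Fin n) => Function.Involutive τ)).filter
              (fun τ => τ.support.card / 2 = b),
          2 ^ (τ.support.card / 2) * (n - τ.support.card).choose (n - k) * 2 ^ (n - k)) =
        if 2 * b ≤ k then 2 ^ (n - k) * n.choose k *
          (k.choose (2 * b) * ((2 * b).factorial / b.factorial)) else 0 := by
      intro b hb
      have hb' : b ≤ n / 2 := by
        rw [Finset.mem_range] at hb
        omega
      rw [Finset.filter_filter]
      simp only [invol_cycleType]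
      rw [Finset.sum_congr rfl
        (g := fun _ => 2 ^ b * (n - 2 * b).choose (n - k) * 2 ^ (n - k))]
      · rw [Finset.sum_const, smul_eq_mul]
        split_ifs with h
        · have := arith n k b _ hk h (card_cyc n b hb')
          rw [← mul_assoc, this]
          ring
        · rw [Nat.choose_eq_zero_of_lt (by omega)]
          simp
      · intro τ hτ
        simp only [Finset.mem_filter, Finset.mem_univ, true_and] at hτ
        have h1 := τ.sum_cycleType
        rw [hτ] at h1
        simp at h1
        have h2 : τ.support.card = 2 * b := by omega
        rw [h2, Nat.mul_div_cancel_left b (by norm_num)]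
    rw [Finset.sum_congr rfl key, aseq, Finset.mul_sum, ← Finset.sum_filter]
    refine Finset.sum_congr ?_ (fun _ _ => rfl)
    ext b
    simp only [Finset.mem_filter, Finset.mem_range]
    omega
  · intro τ _
    have : τ.support.card ≤ n := by simpa using τ.support.card_le_univ
    simp only [Finset.mem_range]
    omega
end

section
/- For every real number x, the series Σ_{n=0}^{∞} Z_n·x^n/n! converges and its sum equals e^{3x + x²}, where Z_n is the number of skew-symmetric (n,n)-clans. -/
/-- Clans supported on a subset `S`, for a general reflection `r`. -/
def IsC {α : Type} (r : α → α) (S : Finset α) (p : (α → α) × (α → Bool)) : Prop :=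
  (∀ i, p.1 (p.1 i) = i) ∧ (∀ i, i ∉ S → p.1 i = i ∧ p.2 i = true) ∧
  (∀ i, p.1 i ≠ i → p.2 i = true) ∧ (∀ i, p.1 (r i) = r (p.1 i)) ∧
  (∀ i, i ∈ S → p.1 i = i → p.2 (r i) = !(p.2 i))

open Classical in
/-- The finset of such clans. -/
noncomputable def CS {α : Type} [Fintype α] (r : α → α) (S : Finset α) :
    Finset ((α → α) × (α → Bool)) :=
  Finset.univ.filter (IsC r S)

open Classical in
theorem CS_fiber {α : Type} [Fintype α] (r : α → α) (hr : ∀ i, r (r i) = i)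
    (S T : Finset α) (hS : ∀ i, i ∈ S → r i ∈ S) (hT : ∀ i, i ∈ T → r i ∈ T) (hTS : T ⊆ S)
    (g : α → α) (t : α → Bool)
    (h1 : ∀ i, i ∈ T → g i ∈ T ∧ g (g i) = i)
    (h2 : ∀ i, i ∈ T → g i ≠ i → t i = true)
    (h3 : ∀ i, i ∈ T → g (r i) = r (g i))
    (h4 : ∀ i, i ∈ T → g i = i → t (r i) = !(t i)) :
    ((CS r S).filter (fun p => ∀ i, i ∈ T → p.1 i = g i ∧ p.2 i = t i)).card
      = (CS r (S \ T)).card := by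
  have hT' : ∀ i, r i ∈ T ↔ i ∈ T := fun i => ⟨fun h => by simpa [hr] using hT _ h, hT i⟩
  refine Finset.card_nbij'
    (fun p => (fun i => if i ∈ T then i else p.1 i, fun i => if i ∈ T then true else p.2 i))
    (fun p => (fun i => if i ∈ T then g i else p.1 i, fun i => if i ∈ T then t i else p.2 i))
    ?_ ?_ ?_ ?_
  · rintro ⟨f, s⟩ h
    simp only [CS, IsC, Finset.coe_filter, Finset.mem_filter, Finset.mem_univ, true_and,
      Set.mem_ofPred_eq, Finset.mem_sdiff] at h ⊢
    obtain ⟨⟨a1, a2, a3, a4, a5⟩, a6⟩ := h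
    have key : ∀ i, i ∉ T → f i ∉ T := by
      intro i hi hf
      have := (a6 _ hf).1
      rw [a1] at this
      exact hi (this ▸ (h1 _ hf).1)
    refine ⟨?_, ?_, ?_, ?_, ?_⟩
    · intro i; grind
    · intro i; grind
    · intro i; grind
    · intro i; grind
    · intro i; grind
  · rintro ⟨f, s⟩ h
    simp only [CS, IsC, Finset.coe_filter, Finset.mem_filter, Finset.mem_univ, true_and,
      Set.mem_ofPred_eq, Finset.mem_sdiff] at h ⊢
    obtain ⟨a1, a2, a3, a4, a5⟩ := h
    have a7 : ∀ i, i ∈ T → f i = i := by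
      intro i hi
      exact (a2 i (by tauto)).1
    have key : ∀ i, i ∉ T → f i ∉ T := by
      intro i hi hf
      have := a7 _ hf
      rw [a1] at this
      exact hi (this ▸ hf)
    refine ⟨⟨?_, ?_, ?_, ?_, ?_⟩, ?_⟩
    · intro i; grind
    · intro i; grind
    · intro i; grind
    · intro i; grind
    · intro i; grind
    · intro i; grind
  · rintro ⟨f, s⟩ h
    simp only [CS, IsC, Finset.coe_filter, Finset.mem_filter, Finset.mem_univ, true_and,
      Set.mem_ofPred_eq, Finset.mem_sdiff] at h ⊢
    obtain ⟨⟨a1, a2, a3, a4, a5⟩, a6⟩ := h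
    ext i <;> grind
  · rintro ⟨f, s⟩ h
    simp only [CS, IsC, Finset.coe_filter, Finset.mem_filter, Finset.mem_univ, true_and,
      Set.mem_ofPred_eq, Finset.mem_sdiff] at h ⊢
    obtain ⟨a1, a2, a3, a4, a5⟩ := h
    ext i <;> grind

/-- The recurrence sequence. -/
def zz : ℕ → ℕ
  | 0 => 1
  | 1 => 3
  | (n + 2) => 3 * zz (n + 1) + 2 * (n + 1) * zz n

open Classical in
theorem CS_card {α : Type} [Fintype α] (r : α → α) (hr : ∀ i, r (r i) = i)
    (hr' : ∀ i, r i ≠ i) (m : ℕ) : ∀ (S : Finset α), (∀ i, i ∈ S → r i ∈ S) →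
    S.card = 2 * m → (CS r S).card = zz m := by
  induction m using Nat.strong_induction_on with
  | _ m ih =>
  intro S hS hc
  rcases Nat.eq_zero_or_pos m with rfl | hm
  · have : S = ∅ := by simpa using hc
    subst this
    rw [zz, Finset.card_eq_one]
    refine ⟨(fun i => i, fun _ => true), ?_⟩
    ext ⟨f, s⟩
    simp only [CS, IsC, Finset.mem_filter, Finset.mem_univ, true_and, Finset.mem_singleton,
      Finset.notMem_empty, not_false_eq_true, forall_true_left, Prod.mk.injEq, funext_iff]
    grind
  · have hne : S.Nonempty := by
      rw [← Finset.card_pos]; omega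
    obtain ⟨a, ha⟩ := hne
    have hra := hS a ha
    -- removing the pair of a
    have hT1 : ({a, r a} : Finset α) ⊆ S := by
      intro i; simp only [Finset.mem_insert, Finset.mem_singleton]; grind
    have c1 : (S \ {a, r a}).card = 2 * (m - 1) := by
      rw [Finset.card_sdiff_of_subset hT1, Finset.card_pair (hr' a).symm]; omega
    have cl1 : ∀ i, i ∈ S \ {a, r a} → r i ∈ S \ {a, r a} := by
      intro i; simp only [Finset.mem_sdiff, Finset.mem_insert, Finset.mem_singleton]; grind
    have A : ∀ v : Bool, ((CS r S).filter (fun p => p.1 a = a ∧ p.2 a = v)).card = zz (m-1) := by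
      intro v
      rw [← ih (m-1) (by omega) _ cl1 c1]
      rw [← CS_fiber r hr S {a, r a} hS ?_ hT1 (fun i => i) (fun i => if i = a then v else !v)]
      · congr 1
        apply Finset.filter_congr
        rintro ⟨f, s⟩ hp
        simp only [CS, IsC, Finset.mem_filter, Finset.mem_univ, true_and, Finset.mem_insert,
          Finset.mem_singleton] at hp ⊢
        grind
      all_goals simp only [Finset.mem_insert, Finset.mem_singleton]
      all_goals grind
    have B : ((CS r S).filter (fun p => p.1 a = r a)).card = zz (m-1) := by
      rw [← ih (m-1) (by omega) _ cl1 c1]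
      rw [← CS_fiber r hr S {a, r a} hS ?_ hT1 r (fun i => true)]
      · congr 1
        apply Finset.filter_congr
        rintro ⟨f, s⟩ hp
        simp only [CS, IsC, Finset.mem_filter, Finset.mem_univ, true_and, Finset.mem_insert,
          Finset.mem_singleton] at hp ⊢
        grind
      all_goals simp only [Finset.mem_insert, Finset.mem_singleton]
      all_goals grind
    have C : ∀ b ∈ S \ {a, r a}, ((CS r S).filter (fun p => p.1 a = b)).card = zz (m-2) := by
      intro b hb
      have hrb := cl1 b hb
      simp only [Finset.mem_sdiff, Finset.mem_insert, Finset.mem_singleton, not_or] at hb hrb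
      obtain ⟨hb1, hb2, hb3⟩ := hb
      obtain ⟨hb4, hb5, hb6⟩ := hrb
      have hT2 : ({a, r a, b, r b} : Finset α) ⊆ S := by
        intro i; simp only [Finset.mem_insert, Finset.mem_singleton]; grind
      have c4 : ({a, r a, b, r b} : Finset α).card = 4 := by
        have := hr' a
        have := hr' b
        rw [Finset.card_insert_of_notMem, Finset.card_insert_of_notMem, Finset.card_pair]
        all_goals try simp only [Finset.mem_insert, Finset.mem_singleton]
        all_goals grind
      have c2 : (S \ {a, r a, b, r b}).card = 2 * (m - 2) := by
        rw [Finset.card_sdiff_of_subset hT2, c4]; omega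
      have hm2 : m - 2 < m := by omega
      have cl2 : ∀ i, i ∈ S \ {a, r a, b, r b} → r i ∈ S \ {a, r a, b, r b} := by
        intro i; simp only [Finset.mem_sdiff, Finset.mem_insert, Finset.mem_singleton]; grind
      have e1 := hr' a
      have e2 := hr' b
      have e3 := hr a
      have e4 := hr b
      rw [← ih (m-2) hm2 _ cl2 c2]
      rw [← CS_fiber r hr S {a, r a, b, r b} hS ?_ hT2
        (fun i => if i = a then b else if i = b then a else if i = r a then r b else r a)
        (fun i => true)]
      · congr 1
        apply Finset.filter_congr
        rintro ⟨f, s⟩ hp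
        simp only [CS, IsC, Finset.mem_filter, Finset.mem_univ, true_and, Finset.mem_insert,
          Finset.mem_singleton] at hp ⊢
        obtain ⟨a1, a2, a3, a4, a5⟩ := hp
        constructor
        · intro h
          have f1 : f b = a := by rw [← h, a1]
          have f2 : f (r a) = r b := by rw [a4, h]
          have f3 : f (r b) = r a := by rw [a4, f1]
          rintro i (rfl | rfl | rfl | rfl) <;> grind
        · intro h
          have := (h a (by simp)).1
          simpa using this
      all_goals simp only [Finset.mem_insert, Finset.mem_singleton]
      · rintro i (rfl | rfl | rfl | rfl) <;> grind
      · rintro i (rfl | rfl | rfl | rfl) <;> grind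
      · rintro i (rfl | rfl | rfl | rfl) <;> grind
      · rintro i (rfl | rfl | rfl | rfl) <;> grind
      · rintro i (rfl | rfl | rfl | rfl) <;> grind
    have D : (CS r S).card = ∑ b ∈ S, ((CS r S).filter (fun p => p.1 a = b)).card := by
      apply Finset.card_eq_sum_card_fiberwise
      rintro ⟨f, s⟩ hp
      simp only [CS, IsC, Finset.coe_filter, Finset.mem_univ, true_and, Set.mem_ofPred_eq,
        Finset.mem_coe] at hp ⊢
      grind
    have E : ((CS r S).filter (fun p => p.1 a = a)).card = 2 * zz (m-1) := by
      rw [← Finset.card_filter_add_card_filter_not (fun p => p.2 a = true), Finset.filter_filter,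
        Finset.filter_filter, A true]
      have := A false
      simp only [Bool.not_eq_true]
      rw [this]; ring
    rw [D, ← Finset.sum_sdiff hT1, Finset.sum_congr rfl C, Finset.sum_const, c1,
      Finset.sum_pair (hr' a).symm, E, B]
    obtain ⟨k, rfl⟩ : ∃ k, m = k + 1 := ⟨m - 1, by omega⟩
    rcases k with _ | k
    · simp [zz]
    · simp only [zz, Nat.add_sub_cancel, smul_eq_mul]
      have : k + 1 + 1 - 2 = k := by omega
      rw [this]; ring

theorem Znum_eq (n : ℕ) : Znum n = zz n := by
  classical
  have hr' : ∀ i : Fin (2 * n), Fin.rev i ≠ i := by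
    intro i h
    have := congrArg Fin.val h
    rw [Fin.val_rev] at this
    omega
  rw [← CS_card (α := Fin (2 * n)) Fin.rev Fin.rev_rev hr' n Finset.univ (by simp) (by simp)]
  rw [Znum, ← Nat.card_eq_finsetCard]
  refine Nat.card_congr
    { toFun := fun p => ⟨(p.1.1, p.1.2), ?_⟩
      invFun := fun p => ⟨(Function.Involutive.toPerm p.1.1 ?_, p.1.2), ?_⟩
      left_inv := ?_
      right_inv := ?_ }
  · obtain ⟨⟨f, s⟩, h1, h2, h3, h4, h5⟩ := p
    simp only [CS, IsC, Finset.mem_filter, Finset.mem_univ, true_and]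
    exact ⟨h1, by simp, h2, h4, fun i _ => h5 i⟩
  · have := p.2
    simp only [CS, IsC, Finset.mem_filter, Finset.mem_univ, true_and] at this
    exact this.1
  · obtain ⟨⟨f, s⟩, h⟩ := p
    simp only [CS, IsC, Finset.mem_filter, Finset.mem_univ, true_and] at h
    obtain ⟨h1, -, h2, h4, h5⟩ := h
    refine ⟨h1, h2, ?_, h4, fun i => h5 i trivial⟩
    refine Finset.card_nbij' Fin.rev Fin.rev ?_ ?_ (fun i _ => Fin.rev_rev i)
      (fun i _ => Fin.rev_rev i)
    · intro i hi
      simp only [Finset.coe_filter, Finset.mem_univ, true_and, Set.mem_ofPred_eq,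
        Function.Involutive.coe_toPerm] at hi ⊢
      refine ⟨(h4 i).trans (congrArg Fin.rev hi.1), by
        have := h5 i trivial hi.1
        rw [hi.2] at this
        exact this⟩
    · intro i hi
      simp only [Finset.coe_filter, Finset.mem_univ, true_and, Set.mem_ofPred_eq,
        Function.Involutive.coe_toPerm] at hi ⊢
      refine ⟨(h4 i).trans (congrArg Fin.rev hi.1), by
        have := h5 i trivial hi.1
        rw [hi.2] at this
        exact this⟩
  · rintro ⟨⟨f, s⟩, h⟩
    apply Subtype.ext
    refine Prod.ext ?_ rfl
    ext i
    rfl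
  · rintro ⟨⟨f, s⟩, h⟩
    rfl

/-- Coefficients of exp(x^2). -/
noncomputable def ee (l : ℕ) : ℝ := if Even l then 1 / ((l / 2).factorial : ℝ) else 0

theorem ee_hasSum (x : ℝ) : HasSum (fun l => ee l * x ^ l) (Real.exp (x ^ 2)) := by
  have h := NormedSpace.expSeries_div_hasSum_exp (x ^ 2)
  rw [← Real.exp_eq_exp_ℝ] at h
  have inj : Function.Injective (fun j : ℕ => 2 * j) := fun a b h => by simpa using h
  rw [← inj.hasSum_iff]
  · refine (congrArg (fun F : ℕ → ℝ => HasSum F (Real.exp (x ^ 2))) (funext fun j => ?_)).mpr h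
    show ee (2 * j) * x ^ (2 * j) = (x ^ 2) ^ j / (j.factorial : ℝ)
    unfold ee
    rw [if_pos (even_two_mul j), Nat.mul_div_cancel_left _ two_pos, pow_mul]
    ring
  · intro l hl
    have : ¬ Even l := by
      rintro ⟨j, rfl⟩
      exact hl ⟨j, by ring⟩
    simp [ee, this]

/-- Convolution coefficients. -/
noncomputable def cc (n : ℕ) : ℝ :=
  ∑ p ∈ Finset.HasAntidiagonal.antidiagonal n, (3 ^ p.1 / (p.1.factorial : ℝ)) * ee p.2

theorem cc_hasSum (x : ℝ) : HasSum (fun n => cc n * x ^ n) (Real.exp (3 * x + x ^ 2)) := by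
  have hf := NormedSpace.expSeries_div_hasSum_exp (3 * x)
  rw [← Real.exp_eq_exp_ℝ] at hf
  have hg := ee_hasSum x
  have nf := hf.summable.norm
  have ng := hg.summable.norm
  have h1 := summable_norm_sum_mul_antidiagonal_of_summable_norm nf ng
  have h2 := tsum_mul_tsum_eq_tsum_sum_antidiagonal_of_summable_norm nf ng
  rw [hf.tsum_eq, hg.tsum_eq, ← Real.exp_add] at h2
  rw [h2]
  refine (congrArg (fun F : ℕ → ℝ => HasSum F _) (funext fun n => ?_)).mpr h1.of_norm.hasSum
  rw [cc, Finset.sum_mul]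
  refine Finset.sum_congr rfl fun p hp => ?_
  rw [← Finset.HasAntidiagonal.mem_antidiagonal.mp hp, pow_add, mul_pow]
  ring

theorem ee_rec (l : ℕ) : ((l : ℝ) + 2) * ee (l + 2) = 2 * ee l := by
  unfold ee
  by_cases h : Even l
  · obtain ⟨j, rfl⟩ := h
    have h1 : Even (j + j + 2) := ⟨j + 1, by ring⟩
    have h2 : (j + j + 2) / 2 = j + 1 := by omega
    have h3 : (j + j) / 2 = j := by omega
    rw [if_pos h1, if_pos ⟨j, rfl⟩, h2, h3, Nat.factorial_succ]
    push_cast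
    have := Nat.factorial_ne_zero j
    field_simp
    ring
  · have h1 : ¬ Even (l + 2) := by
      rw [Nat.even_add]; simp [h]
    simp [h, h1]

theorem cc_ps : ∃ C : PowerSeries ℝ, (∀ n, PowerSeries.coeff n C = cc n) ∧
    PowerSeries.derivative ℝ C = 3 * C + 2 * (PowerSeries.X * C) := by
  have hA : PowerSeries.derivative ℝ (PowerSeries.mk fun n => (3 : ℝ) ^ n / (n.factorial : ℝ))
      = 3 * (PowerSeries.mk fun n => (3 : ℝ) ^ n / (n.factorial : ℝ)) := by
    ext n
    have h3 : (3 : PowerSeries ℝ) = PowerSeries.C (3 : ℝ) := (map_ofNat PowerSeries.C 3).symm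
    rw [h3, PowerSeries.coeff_derivative, PowerSeries.coeff_C_mul, PowerSeries.coeff_mk,
      PowerSeries.coeff_mk, Nat.factorial_succ]
    push_cast
    have := Nat.factorial_ne_zero n
    field_simp
    try ring
  have hB : PowerSeries.derivative ℝ (PowerSeries.mk ee)
      = 2 * (PowerSeries.X * PowerSeries.mk ee) := by
    ext n
    have h3 : (2 : PowerSeries ℝ) = PowerSeries.C (2 : ℝ) := (map_ofNat PowerSeries.C 2).symm
    rw [h3, PowerSeries.coeff_derivative, PowerSeries.coeff_C_mul, PowerSeries.coeff_mk]
    rcases n with _ | n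
    · simp [ee]
    · rw [PowerSeries.coeff_succ_X_mul, PowerSeries.coeff_mk, ← ee_rec]
      push_cast
      ring
  refine ⟨(PowerSeries.mk fun n => (3 : ℝ) ^ n / (n.factorial : ℝ)) * PowerSeries.mk ee, ?_, ?_⟩
  · intro n
    simp [PowerSeries.coeff_mul, cc]
  · rw [Derivation.leibniz, hA, hB, smul_eq_mul, smul_eq_mul]
    ring

theorem zz_cc (n : ℕ) : (zz n : ℝ) = n.factorial * cc n := by
  obtain ⟨C, hC, hd⟩ := cc_ps
  have rec1 : ∀ n, cc (n + 2) * ((n : ℝ) + 2) = 3 * cc (n + 1) + 2 * cc n := by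
    intro n
    have := congrArg (PowerSeries.coeff (n + 1)) hd
    have h3 : (3 : PowerSeries ℝ) = PowerSeries.C (3 : ℝ) := (map_ofNat PowerSeries.C 3).symm
    have h2 : (2 : PowerSeries ℝ) = PowerSeries.C (2 : ℝ) := (map_ofNat PowerSeries.C 2).symm
    rw [h3, h2, map_add, PowerSeries.coeff_derivative, PowerSeries.coeff_C_mul,
      PowerSeries.coeff_C_mul, PowerSeries.coeff_succ_X_mul, hC, hC, hC] at this
    rw [← this]; push_cast; ring
  have H : ∀ n, (zz n : ℝ) = n.factorial * cc n ∧
      (zz (n + 1) : ℝ) = (n + 1).factorial * cc (n + 1) := by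
    intro n
    induction n with
    | zero =>
      constructor
      · simp [zz, cc, ee]
      · simp [zz, cc, ee, Finset.Nat.antidiagonal_succ]
    | succ n ih =>
      refine ⟨ih.2, ?_⟩
      rw [zz]
      push_cast
      rw [ih.1, ih.2]
      have := rec1 n
      simp only [Nat.factorial_succ]
      push_cast
      linear_combination (-((n : ℝ) + 1) * n.factorial) * this
  exact (H n).1

theorem zz_hasSum (x : ℝ) :
    HasSum (fun n : ℕ => (zz n : ℝ) * x ^ n / (Nat.factorial n : ℝ))
      (Real.exp (3 * x + x ^ 2)) := by
  convert cc_hasSum x using 2 with n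
  rw [zz_cc]
  have := Nat.factorial_ne_zero n
  field_simp

/-- for every real `x`, the series `Σ Z_n·xⁿ/n!` converges with sum
`e^(3x + x²)`. -/
theorem stmt8 (x : ℝ) :
    HasSum (fun n : ℕ => (Znum n : ℝ) * x ^ n / (Nat.factorial n : ℝ))
      (Real.exp (3 * x + x ^ 2)) := by
  simp only [Znum_eq]
  exact zz_hasSum x
end

section
/- There is a bijection between the set ℒ^w(n,n) of weighted (n,n) Delannoy paths and the set of skew-symmetric (n,n)-clans; in particular |ℒ^w(n,n)| = Z_n. -/
/-- Labeled steps are pairs `(L, l)` with `L : Fin 3` (`0` = north `N`, `1` = east `E`,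
`2` = diagonal `D`) and `l : ℕ` the weight.  `wdIdx W` is the (increasing) list of
indices of the steps of the word `W` that are not the weight-one diagonal step `(D,1)`,
i.e. the index sequence `i_1 < … < i_t` of the paper (0-indexed). -/
def wdIdx (W : List (Fin 3 × ℕ)) : List ℕ :=
  (List.range W.length).filter (fun i => decide (W.getD i (0, 0) ≠ ((2 : Fin 3), 1)))

/-- `mcount W i = m_i`: the number of steps strictly before position `i` whose weight
is different from `1`. -/
def mcount (W : List (Fin 3 × ℕ)) (i : ℕ) : ℕ :=
  ((List.range W.length).filter (fun k => decide (k < i ∧ (W.getD k (0, 0)).2 ≠ 1))).length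

/-- `dcount W i = d_i`: the number of steps strictly after position `i` equal to `(D,1)`. -/
def dcount (W : List (Fin 3 × ℕ)) (i : ℕ) : ℕ :=
  ((List.range W.length).filter
    (fun k => decide (i < k ∧ W.getD k (0, 0) = ((2 : Fin 3), 1)))).length

/-- A *weighted `(n,n)` Delannoy path*: a word `W = W_1 … W_r` of labeled steps
`W_i = (L_i, l_i)` such that (in the notation of the paper, with `i_1 < … < i_t` the
indices of the steps different from `(D,1)`):
* each weight is a positive integer and equals `1` on `N` and `E` steps;
* `L_1 … L_r` is a lattice path from `(0,0)` to `(n,n)` (i.e. `#N + #D = #E + #D = n`);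
* `t` is even and every index `i` with `W_i = (D,1)` satisfies `i > i_{t/2}`;
* `L_{i_j} = N` iff `L_{i_{t+1−j}} = E` for `1 ≤ j ≤ t`;
* if `l_{i_j} ≠ 1` for some `1 ≤ j ≤ t/2`, then
  `W_{i_{t+1−j}} = (D, 2n+3−2(i_j + m_{i_j} + d_{i_{t+1−j}}) − l_{i_j})`
  (positions `i_j` are 1-indexed in this formula, as in the paper; here indices are
  0-indexed, whence the `+ 1`). -/
def IsWeightedDelannoy (n : ℕ) (W : List (Fin 3 × ℕ)) : Prop :=
  (∀ w ∈ W, 1 ≤ w.2 ∧ (w.1 ≠ 2 → w.2 = 1)) ∧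
  List.countP (fun w => decide (w.1 = 0 ∨ w.1 = 2)) W = n ∧
  List.countP (fun w => decide (w.1 = 1 ∨ w.1 = 2)) W = n ∧
  Even (wdIdx W).length ∧
  (∀ i < W.length, W.getD i (0, 0) = ((2 : Fin 3), 1) →
    ∀ _ : (wdIdx W).length / 2 - 1 < (wdIdx W).length,
      (wdIdx W).getD ((wdIdx W).length / 2 - 1) 0 < i) ∧
  (∀ j < (wdIdx W).length,
    ((W.getD ((wdIdx W).getD j 0) (0, 0)).1 = 0 ↔
      (W.getD ((wdIdx W).getD ((wdIdx W).length - 1 - j) 0) (0, 0)).1 = 1)) ∧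
  (∀ j < (wdIdx W).length / 2,
    (W.getD ((wdIdx W).getD j 0) (0, 0)).2 ≠ 1 →
      (W.getD ((wdIdx W).getD ((wdIdx W).length - 1 - j) 0) (0, 0)).1 = 2 ∧
      ((W.getD ((wdIdx W).getD ((wdIdx W).length - 1 - j) 0) (0, 0)).2 : ℤ) =
        2 * (n : ℤ) + 3 -
          2 * (((wdIdx W).getD j 0 : ℤ) + 1 +
            (mcount W ((wdIdx W).getD j 0) : ℤ) +
            (dcount W ((wdIdx W).getD ((wdIdx W).length - 1 - j) 0) : ℤ)) -
          ((W.getD ((wdIdx W).getD j 0) (0, 0)).2 : ℤ))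

/-- `e_n`, the number of weighted `(n,n)` Delannoy paths. -/
noncomputable def eDel (n : ℕ) : ℕ :=
  Nat.card {W : List (Fin 3 × ℕ) // IsWeightedDelannoy n W}

namespace WD

abbrev St := Fin 3 × ℕ

def c5 (W : List St) : Prop :=
  (∀ i < W.length, W.getD i (0, 0) = ((2 : Fin 3), 1) →
    ∀ _ : (wdIdx W).length / 2 - 1 < (wdIdx W).length,
      (wdIdx W).getD ((wdIdx W).length / 2 - 1) 0 < i)

def c6 (W : List St) : Prop :=
  (∀ j < (wdIdx W).length,
    ((W.getD ((wdIdx W).getD j 0) (0, 0)).1 = 0 ↔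
      (W.getD ((wdIdx W).getD ((wdIdx W).length - 1 - j) 0) (0, 0)).1 = 1))

def c7 (K : ℤ) (W : List St) : Prop :=
  (∀ j < (wdIdx W).length / 2,
    (W.getD ((wdIdx W).getD j 0) (0, 0)).2 ≠ 1 →
      (W.getD ((wdIdx W).getD ((wdIdx W).length - 1 - j) 0) (0, 0)).1 = 2 ∧
      ((W.getD ((wdIdx W).getD ((wdIdx W).length - 1 - j) 0) (0, 0)).2 : ℤ) =
        K + 3 -
          2 * (((wdIdx W).getD j 0 : ℤ) + 1 +
            (mcount W ((wdIdx W).getD j 0) : ℤ) +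
            (dcount W ((wdIdx W).getD ((wdIdx W).length - 1 - j) 0) : ℤ)) -
          ((W.getD ((wdIdx W).getD j 0) (0, 0)).2 : ℤ))

theorem isWD_iff (n : ℕ) (W : List St) : IsWeightedDelannoy n W ↔
    (∀ w ∈ W, 1 ≤ w.2 ∧ (w.1 ≠ 2 → w.2 = 1)) ∧
    List.countP (fun w => decide (w.1 = 0 ∨ w.1 = 2)) W = n ∧
    List.countP (fun w => decide (w.1 = 1 ∨ w.1 = 2)) W = n ∧
    Even (wdIdx W).length ∧ c5 W ∧ c6 W ∧ c7 (2 * (n : ℤ)) W := Iff.rfl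

theorem wdIdx_lt (W : List St) {j : ℕ} (hj : j < (wdIdx W).length) :
    (wdIdx W).getD j 0 < W.length := by
  have h : (wdIdx W).getD j 0 ∈ wdIdx W := by
    rw [List.getD_eq_getElem _ _ hj]; exact List.getElem_mem hj
  have := List.mem_of_mem_filter h
  simpa using this

theorem getD_snoc (W : List St) (b : St) {i : ℕ} (hi : i < W.length) :
    (W ++ [b]).getD i (0, 0) = W.getD i (0, 0) := by
  rw [List.getD_append _ _ _ _ hi]

theorem getD_snoc_len (W : List St) (b : St) :
    (W ++ [b]).getD W.length (0, 0) = b := by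
  rw [List.getD_append_right _ _ _ _ le_rfl]; simp

/-! ### appending -/

theorem wdIdx_snoc (W : List St) (b : St) :
    wdIdx (W ++ [b]) = wdIdx W ++ (if b = (2, 1) then [] else [W.length]) := by
  unfold wdIdx
  rw [List.length_append, List.length_singleton, List.range_succ, List.filter_append]
  congr 1
  · apply List.filter_congr
    intro i hi
    rw [getD_snoc _ _ (by simpa using hi)]
  · rw [List.filter_singleton, getD_snoc_len]
    by_cases h : b = (2, 1) <;> simp [h]

theorem wdIdx_cons (W : List St) (a : St) :
    wdIdx (a :: W) = (if a = (2, 1) then [] else [0]) ++ (wdIdx W).map (· + 1) := by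
  unfold wdIdx
  rw [List.length_cons, List.range_succ_eq_map, List.filter_cons, List.filter_map]
  by_cases h : a = (2, 1) <;> simp [h] <;> rfl

theorem mcount_snoc (W : List St) (b : St) {i : ℕ} (hi : i ≤ W.length) :
    mcount (W ++ [b]) i = mcount W i := by
  unfold mcount
  rw [List.length_append, List.length_singleton, List.range_succ, List.filter_append,
    List.length_append, List.filter_singleton]
  have : ¬ (W.length < i) := by omega
  simp only [this, false_and, decide_false, cond_false, List.length_nil, Bool.false_eq_true,
    if_false, add_zero]
  congr 1
  apply List.filter_congr
  intro k hk
  rw [getD_snoc _ _ (by simpa using hk)]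

theorem mcount_cons (W : List St) (a : St) (i : ℕ) :
    mcount (a :: W) (i + 1) = (if a.2 = 1 then 0 else 1) + mcount W i := by
  unfold mcount
  rw [List.length_cons, List.range_succ_eq_map, List.filter_cons, List.filter_map]
  by_cases h : a.2 = 1 <;> simp [h, Function.comp_def]
  omega

theorem mcount_zero (W : List St) : mcount W 0 = 0 := by
  simp [mcount]

theorem dcount_snoc (W : List St) (b : St) {i : ℕ} (hi : i < W.length) :
    dcount (W ++ [b]) i = dcount W i + (if b = (2, 1) then 1 else 0) := by
  unfold dcount
  rw [List.length_append, List.length_singleton, List.range_succ, List.filter_append,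
    List.length_append, List.filter_singleton, getD_snoc_len]
  congr 1
  · congr 1
    apply List.filter_congr
    intro k hk
    rw [getD_snoc _ _ (by simpa using hk)]
  · by_cases h : b = (2, 1) <;> simp [h, hi]

theorem dcount_cons (W : List St) (a : St) (i : ℕ) :
    dcount (a :: W) (i + 1) = dcount W i := by
  unfold dcount
  rw [List.length_cons, List.range_succ_eq_map, List.filter_cons, List.filter_map]
  simp [Function.comp_def]

theorem dcount_last (W : List St) {i : ℕ} (h : W.length ≤ i + 1) : dcount W i = 0 := by
  unfold dcount
  rw [List.length_eq_zero_iff, List.filter_eq_nil_iff]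
  intro k hk
  simp at hk
  simp
  intro; omega

/-! ### Appending `(D,1)` -/

theorem c5_D (W : List St) : c5 (W ++ [((2 : Fin 3), 1)]) ↔ c5 W := by
  unfold c5
  have hI : wdIdx (W ++ [((2 : Fin 3), 1)]) = wdIdx W := by simp [wdIdx_snoc]
  rw [hI]
  constructor
  · intro h i hi h1 h2
    exact h i (by simp; omega) (by rwa [getD_snoc _ _ hi]) h2
  · intro h i hi h1 h2
    by_cases hh : i < W.length
    · exact h i hh (by rwa [getD_snoc _ _ hh] at h1) h2
    · have := wdIdx_lt W h2
      omega

theorem c6_D (W : List St) : c6 (W ++ [((2 : Fin 3), 1)]) ↔ c6 W := by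
  unfold c6
  have hI : wdIdx (W ++ [((2 : Fin 3), 1)]) = wdIdx W := by simp [wdIdx_snoc]
  rw [hI]
  refine forall_congr' fun j => forall_congr' fun hj => ?_
  rw [getD_snoc _ _ (wdIdx_lt W hj),
    getD_snoc _ _ (wdIdx_lt W (j := (wdIdx W).length - 1 - j) (by omega))]

theorem c7_D (K : ℤ) (W : List St) : c7 K (W ++ [((2 : Fin 3), 1)]) ↔ c7 (K - 2) W := by
  unfold c7
  have hI : wdIdx (W ++ [((2 : Fin 3), 1)]) = wdIdx W := by simp [wdIdx_snoc]
  rw [hI]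
  refine forall_congr' fun j => forall_congr' fun hj => ?_
  have h1 := wdIdx_lt W (j := j) (by omega)
  have h2 := wdIdx_lt W (j := (wdIdx W).length - 1 - j) (by omega)
  rw [getD_snoc _ _ h1, getD_snoc _ _ h2, mcount_snoc _ _ h1.le, dcount_snoc _ _ h2]
  refine imp_congr_right fun _ => and_congr_right fun _ => ?_
  rw [if_pos rfl]; push_cast
  constructor <;> intro h <;> linarith

theorem P_D (n : ℕ) (W : List St) :
    IsWeightedDelannoy (n + 1) (W ++ [((2 : Fin 3), 1)]) ↔ IsWeightedDelannoy n W := by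
  rw [isWD_iff, isWD_iff, c5_D, c6_D, c7_D]
  have hI : wdIdx (W ++ [((2 : Fin 3), 1)]) = wdIdx W := by simp [wdIdx_snoc]
  have hK : (2 * ((n + 1 : ℕ) : ℤ) - 2) = 2 * (n : ℤ) := by push_cast; ring
  rw [hI, hK]
  simp [or_imp, forall_and]

/-! ### Wrapping -/

section wrap
variable {a b : St} (ha : a ≠ ((2 : Fin 3), 1)) (hb : b ≠ ((2 : Fin 3), 1)) (W : List St)
include ha hb

theorem wdIdx_wrap : wdIdx (a :: (W ++ [b])) =
    0 :: ((wdIdx W).map (· + 1) ++ [W.length + 1]) := by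
  rw [wdIdx_cons, wdIdx_snoc, if_neg ha, if_neg hb]; simp

theorem len_wrap : (wdIdx (a :: (W ++ [b]))).length = (wdIdx W).length + 2 := by
  rw [wdIdx_wrap ha hb]; simp

theorem idx_zero : (wdIdx (a :: (W ++ [b]))).getD 0 0 = 0 := by
  rw [wdIdx_wrap ha hb]; simp

theorem idx_last {j : ℕ} (hj : j = (wdIdx W).length + 1) :
    (wdIdx (a :: (W ++ [b]))).getD j 0 = W.length + 1 := by
  rw [wdIdx_wrap ha hb, hj, List.getD_cons_succ, List.getD_append_right _ _ _ _ (by simp)]; simp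

theorem idx_mid {i j : ℕ} (hj : j < (wdIdx W).length) (hi : i = j + 1) :
    (wdIdx (a :: (W ++ [b]))).getD i 0 = (wdIdx W).getD j 0 + 1 := by
  rw [wdIdx_wrap ha hb, hi, List.getD_cons_succ, List.getD_append _ _ _ _ (by simpa using hj)]
  simp [List.getD_eq_getElem _ _ hj, hj]

omit ha hb in
theorem get_mid {i : ℕ} (hi : i < W.length) :
    (a :: (W ++ [b])).getD (i + 1) (0, 0) = W.getD i (0, 0) := by
  rw [List.getD_cons_succ, getD_snoc _ _ hi]

omit ha hb in
theorem get_last : (a :: (W ++ [b])).getD (W.length + 1) (0, 0) = b := by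
  rw [List.getD_cons_succ, getD_snoc_len]

theorem c5_wrap (he : Even (wdIdx W).length) : c5 (a :: (W ++ [b])) ↔ c5 W := by
  unfold c5
  rw [len_wrap ha hb]
  obtain ⟨k, hk⟩ := he
  constructor
  · intro h i hi h1 h2
    have := h (i + 1) (by simp; omega) (by rwa [get_mid _ hi]) (by omega)
    rw [idx_mid ha hb W (j := (wdIdx W).length / 2 - 1) h2 (by omega)] at this
    omega
  · intro h i hi h1 _
    rcases i with _ | i
    · simp at h1; exact absurd h1 ha
    · by_cases hh : i < W.length
      · rw [get_mid _ hh] at h1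
        by_cases hk0 : k = 0
        · have : ((wdIdx W).length + 2) / 2 - 1 = 0 := by omega
          rw [this, idx_zero ha hb]; omega
        · have := h i hh h1 (by omega)
          rw [idx_mid ha hb W (j := (wdIdx W).length / 2 - 1) (by omega) (by omega)]
          omega
      · have : i = W.length := by simp at hi; omega
        subst this
        rw [get_last] at h1; exact absurd h1 hb

theorem c6_wrap : c6 (a :: (W ++ [b])) ↔
    ((a.1 = 0 ↔ b.1 = 1) ∧ (b.1 = 0 ↔ a.1 = 1) ∧ c6 W) := by
  unfold c6
  rw [len_wrap ha hb]
  constructor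
  · intro h
    refine ⟨?_, ?_, ?_⟩
    · have := h 0 (by omega)
      rw [idx_zero ha hb, idx_last ha hb W (by omega), get_last] at this
      simpa using this
    · have := h ((wdIdx W).length + 1) (by omega)
      rw [show (wdIdx W).length + 2 - 1 - ((wdIdx W).length + 1) = 0 by omega,
        idx_zero ha hb, idx_last ha hb W (by omega), get_last] at this
      simpa using this
    · intro j hj
      have := h (j + 1) (by omega)
      rwa [idx_mid ha hb W hj rfl,
        idx_mid ha hb W (j := (wdIdx W).length - 1 - j) (by omega) (by omega),
        get_mid _ (wdIdx_lt W hj), get_mid _ (wdIdx_lt W (by omega))] at this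
  · rintro ⟨h1, h2, h3⟩ j hj
    rcases j with _ | j
    · rw [idx_zero ha hb, idx_last ha hb W (by omega), get_last]
      simpa using h1
    · by_cases hh : j < (wdIdx W).length
      · rw [idx_mid ha hb W hh rfl,
          idx_mid ha hb W (j := (wdIdx W).length - 1 - j) (by omega) (by omega),
          get_mid _ (wdIdx_lt W hh), get_mid _ (wdIdx_lt W (by omega))]
        exact h3 j hh
      · have : j = (wdIdx W).length := by omega
        subst this
        rw [show (wdIdx W).length + 2 - 1 - ((wdIdx W).length + 1) = 0 by omega,
          idx_zero ha hb, idx_last ha hb W (by omega), get_last]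
        simpa using h2

theorem c7_wrap (K : ℤ) : c7 K (a :: (W ++ [b])) ↔
    ((a.2 ≠ 1 → b.1 = 2 ∧ (b.2 : ℤ) = K + 1 - a.2) ∧
      c7 (K - 2 - (if a.2 = 1 then 0 else 2)) W) := by
  have key : ∀ j < (wdIdx W).length / 2, (mcount (a :: (W ++ [b])) ((wdIdx W).getD j 0 + 1) : ℤ)
      = (if a.2 = 1 then 0 else 1) + mcount W ((wdIdx W).getD j 0) ∧
      dcount (a :: (W ++ [b])) ((wdIdx W).getD ((wdIdx W).length - 1 - j) 0 + 1)
      = dcount W ((wdIdx W).getD ((wdIdx W).length - 1 - j) 0) := by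
    intro j hj
    rw [mcount_cons, dcount_cons, mcount_snoc _ _ (wdIdx_lt W (by omega)).le,
      dcount_snoc _ _ (wdIdx_lt W (by omega)), if_neg hb]
    push_cast; simp
  unfold c7
  rw [len_wrap ha hb]
  constructor
  · intro h
    refine ⟨?_, ?_⟩
    · have := h 0 (by omega)
      rw [idx_zero ha hb, idx_last ha hb W (by omega), get_last, mcount_zero,
        dcount_last _ (by simp)] at this
      intro h0
      obtain ⟨h1, h2⟩ := this (by simpa using h0)
      refine ⟨h1, ?_⟩
      simp at h2; linarith
    · intro j hj
      have := h (j + 1) (by omega)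
      rw [idx_mid ha hb W (j := j) (by omega) rfl,
        idx_mid ha hb W (j := (wdIdx W).length - 1 - j) (by omega) (by omega),
        get_mid _ (wdIdx_lt W (by omega)), get_mid _ (wdIdx_lt W (by omega)),
        (key j hj).1, (key j hj).2] at this
      intro h0
      obtain ⟨h1, h2⟩ := this h0
      refine ⟨h1, ?_⟩
      rw [h2]; push_cast
      split_ifs <;> ring
  · rintro ⟨h1, h2⟩ j hj
    rcases j with _ | j
    · rw [idx_zero ha hb, idx_last ha hb W (by omega), get_last, mcount_zero,
        dcount_last _ (by simp)]
      intro h0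
      obtain ⟨h3, h4⟩ := h1 (by simpa using h0)
      refine ⟨h3, ?_⟩
      simp; linarith
    · have := h2 j (by omega)
      rw [idx_mid ha hb W (j := j) (by omega) rfl,
        idx_mid ha hb W (j := (wdIdx W).length - 1 - j) (by omega) (by omega),
        get_mid _ (wdIdx_lt W (by omega)), get_mid _ (wdIdx_lt W (by omega)),
        (key j (by omega)).1, (key j (by omega)).2]
      intro h0
      obtain ⟨h3, h4⟩ := this h0
      refine ⟨h3, ?_⟩
      rw [h4]; push_cast
      split_ifs <;> ring

theorem P_wrap (N : ℕ) : IsWeightedDelannoy N (a :: (W ++ [b])) ↔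
    (1 ≤ a.2 ∧ (a.1 ≠ 2 → a.2 = 1)) ∧ (1 ≤ b.2 ∧ (b.1 ≠ 2 → b.2 = 1)) ∧
    (∀ w ∈ W, 1 ≤ w.2 ∧ (w.1 ≠ 2 → w.2 = 1)) ∧
    List.countP (fun w => decide (w.1 = 0 ∨ w.1 = 2)) W +
      (if a.1 = 0 ∨ a.1 = 2 then 1 else 0) + (if b.1 = 0 ∨ b.1 = 2 then 1 else 0) = N ∧
    List.countP (fun w => decide (w.1 = 1 ∨ w.1 = 2)) W +
      (if a.1 = 1 ∨ a.1 = 2 then 1 else 0) + (if b.1 = 1 ∨ b.1 = 2 then 1 else 0) = N ∧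
    Even (wdIdx W).length ∧ c5 W ∧ ((a.1 = 0 ↔ b.1 = 1) ∧ (b.1 = 0 ↔ a.1 = 1) ∧ c6 W) ∧
    (a.2 ≠ 1 → b.1 = 2 ∧ (b.2 : ℤ) = 2 * (N : ℤ) + 1 - a.2) ∧
      c7 (2 * (N : ℤ) - 2 - (if a.2 = 1 then 0 else 2)) W := by
  rw [isWD_iff, c6_wrap ha hb, c7_wrap ha hb, len_wrap ha hb]
  have e1 : Even ((wdIdx W).length + 2) ↔ Even (wdIdx W).length := by
    simp [Nat.even_add]
  rw [e1]
  have e2 : ∀ p : St → Bool, List.countP p (a :: (W ++ [b])) =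
      List.countP p W + (if p a then 1 else 0) + (if p b then 1 else 0) := by
    intro p
    rw [List.countP_cons, List.countP_append, List.countP_singleton]; omega
  rw [e2, e2]
  simp only [decide_eq_true_eq]
  have e3 : (∀ w ∈ a :: (W ++ [b]), 1 ≤ w.2 ∧ (w.1 ≠ 2 → w.2 = 1)) ↔
    (1 ≤ a.2 ∧ (a.1 ≠ 2 → a.2 = 1)) ∧ (1 ≤ b.2 ∧ (b.1 ≠ 2 → b.2 = 1)) ∧
    (∀ w ∈ W, 1 ≤ w.2 ∧ (w.1 ≠ 2 → w.2 = 1)) := by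
    constructor
    · intro h
      exact ⟨h a (by simp), h b (by simp), fun w hw => h w (by simp [hw])⟩
    · rintro ⟨h1, h2, h3⟩ w hw
      simp only [List.mem_cons, List.mem_append, List.not_mem_nil, or_false] at hw
      rcases hw with rfl | hw | rfl
      · exact h1
      · exact h3 w hw
      · exact h2
  rw [e3]
  constructor
  · rintro ⟨⟨h1, h2, h3⟩, h4, h5, h6, h7, h8, h9⟩
    exact ⟨h1, h2, h3, h4, h5, h6, (c5_wrap ha hb W h6).1 h7, h8, h9⟩
  · rintro ⟨h1, h2, h3, h4, h5, h6, h7, h8, h9⟩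
    exact ⟨⟨h1, h2, h3⟩, h4, h5, h6, (c5_wrap ha hb W h6).2 h7, h8, h9⟩

end wrap

theorem P_NE (n : ℕ) (W : List St) :
    IsWeightedDelannoy (n + 1) (((0 : Fin 3), 1) :: (W ++ [((1 : Fin 3), 1)])) ↔
      IsWeightedDelannoy n W := by
  rw [P_wrap (by simp) (by simp), isWD_iff]
  have hK : (2 * ((n : ℤ) + 1) - 2) = 2 * (n : ℤ) := by ring
  simp [hK]

theorem P_EN (n : ℕ) (W : List St) :
    IsWeightedDelannoy (n + 1) (((1 : Fin 3), 1) :: (W ++ [((0 : Fin 3), 1)])) ↔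
      IsWeightedDelannoy n W := by
  rw [P_wrap (by simp) (by simp), isWD_iff]
  have hK : (2 * ((n : ℤ) + 1) - 2) = 2 * (n : ℤ) := by ring
  simp [hK]

theorem P_DD (n : ℕ) (W : List St) {l m : ℕ} (hl : l ≠ 1) (hm : m ≠ 1) :
    IsWeightedDelannoy (n + 2) (((2 : Fin 3), l) :: (W ++ [((2 : Fin 3), m)])) ↔
      1 ≤ l ∧ 1 ≤ m ∧ l + m = 2 * n + 5 ∧ IsWeightedDelannoy n W := by
  rw [P_wrap (by simp [hl]) (by simp [hm]), isWD_iff]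
  have hK : (2 * ((n : ℤ) + 2) - 2 - 2) = 2 * (n : ℤ) := by ring
  have hL : (m : ℤ) = 2 * ((n : ℤ) + 2) + 1 - l ↔ l + m = 2 * n + 5 := by omega
  simp [hK, hl, hL]
  tauto

theorem P_cases (n : ℕ) (W : List St) (h : IsWeightedDelannoy (n + 1) W) :
    (∃ V, W = V ++ [((2 : Fin 3), 1)] ∧ IsWeightedDelannoy n V) ∨
    (∃ V, W = ((0 : Fin 3), 1) :: (V ++ [((1 : Fin 3), 1)]) ∧ IsWeightedDelannoy n V) ∨
    (∃ V, W = ((1 : Fin 3), 1) :: (V ++ [((0 : Fin 3), 1)]) ∧ IsWeightedDelannoy n V) ∨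
    (∃ k V l m, n = k + 1 ∧ W = ((2 : Fin 3), l) :: (V ++ [((2 : Fin 3), m)]) ∧
      2 ≤ l ∧ 2 ≤ m ∧ l + m = 2 * k + 5 ∧ IsWeightedDelannoy k V) := by
  rcases List.eq_nil_or_concat W with rfl | ⟨V, b, rfl⟩
  · have := h.2.1; simp at this
  · rw [List.concat_eq_append] at h ⊢
    by_cases hb : b = ((2 : Fin 3), 1)
    · subst hb
      exact Or.inl ⟨V, rfl, (P_D n V).1 h⟩
    · rcases V with _ | ⟨a, V⟩
      · have := h.2.2.2.1
        rw [wdIdx_snoc, if_neg hb] at this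
        simp [wdIdx] at this
      · rw [List.cons_append] at h ⊢
        by_cases ha : a = ((2 : Fin 3), 1)
        · exfalso
          subst ha
          have hlen := h.2.2.2.1
          have h5 := h.2.2.2.2.1 0 (by simp) (by simp)
          have : 0 < (wdIdx (((2 : Fin 3), 1) :: (V ++ [b]))).length := by
            rw [wdIdx_cons, wdIdx_snoc, if_neg hb]; simp
          have := h5 (by omega)
          omega
        · have h' := (P_wrap ha hb V (n + 1)).1 h
          obtain ⟨⟨ha1, ha2⟩, ⟨hb1, hb2⟩, -, h4, h5, -, -, ⟨h8, h9, -⟩, h10, -⟩ := h'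
          obtain ⟨a1, a2⟩ := a
          obtain ⟨b1, b2⟩ := b
          dsimp only at *
          fin_cases a1 <;> fin_cases b1 <;> simp at h8 h9 ha2 hb2 h10 ha hb h4 h5 ⊢
          · subst ha2 hb2
            exact Or.inr ⟨⟨rfl, rfl⟩, (P_NE n V).1 h⟩
          · subst ha2 hb2
            exact Or.inr ⟨⟨rfl, rfl⟩, (P_EN n V).1 h⟩
          · have h10 := h10 ha
            obtain ⟨k, rfl⟩ : ∃ k, n = k + 1 := ⟨n - 1, by omega⟩
            have := (P_DD k V ha hb).1 h
            exact Or.inr ⟨k, rfl, by omega, by omega, by omega, this.2.2.2⟩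

theorem P_zero (W : List St) : IsWeightedDelannoy 0 W ↔ W = [] := by
  constructor
  · intro h
    have h1 := h.2.1
    have h2 := h.2.2.1
    rw [List.countP_eq_zero] at h1 h2
    rw [List.eq_nil_iff_forall_not_mem]
    rintro ⟨x, l⟩ hx
    have := h1 _ hx
    have := h2 _ hx
    fin_cases x <;> simp_all
  · rintro rfl
    simp [isWD_iff, c5, c6, c7, wdIdx]

abbrev Pt (n : ℕ) := {W : List St // IsWeightedDelannoy n W}

def glue (n : ℕ) : (Fin 3 × Pt n) ⊕ (Fin (2 * n) × Pt (n - 1)) → List St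
  | Sum.inl (i, V) =>
      if i = 0 then V.1 ++ [((2 : Fin 3), 1)]
      else if i = 1 then ((0 : Fin 3), 1) :: (V.1 ++ [((1 : Fin 3), 1)])
      else ((1 : Fin 3), 1) :: (V.1 ++ [((0 : Fin 3), 1)])
  | Sum.inr (i, V) => ((2 : Fin 3), i.1 + 2) :: (V.1 ++ [((2 : Fin 3), 2 * n + 1 - i.1)])

theorem glue_mem (n : ℕ) (x) : IsWeightedDelannoy (n + 1) (glue n x) := by
  rcases x with ⟨i, V, hV⟩ | ⟨⟨i, hi⟩, V, hV⟩
  · fin_cases i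
    · exact (P_D n V).2 hV
    · exact (P_NE n V).2 hV
    · exact (P_EN n V).2 hV
  · obtain ⟨k, rfl⟩ : ∃ k, n = k + 1 := ⟨n - 1, by omega⟩
    exact (P_DD k V (by omega) (by omega)).2 ⟨by omega, by omega, by omega, hV⟩

theorem snoc_inj {V W : List St} {a b : St} (h : V ++ [a] = W ++ [b]) : V = W ∧ a = b := by
  simpa using List.append_inj' h rfl

theorem glue_inj (n : ℕ) : Function.Injective (glue n) := by
  rintro (⟨i, V, hV⟩ | ⟨⟨i, hi⟩, V, hV⟩) (⟨j, U, hU⟩ | ⟨⟨j, hj⟩, U, hU⟩) h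
  · fin_cases i <;> fin_cases j <;> simp [glue] at h ⊢ <;>
      first
      | exact h
      | (rw [← List.cons_append] at h; have := (snoc_inj h).2; simp at this)
  · fin_cases i <;> simp [glue] at h
    rw [← List.cons_append] at h
    have := (snoc_inj h).2
    simp at this; omega
  · fin_cases j <;> simp [glue] at h
    rw [← List.cons_append] at h
    have := (snoc_inj h).2
    simp at this; omega
  · simp only [glue, List.cons.injEq, Prod.mk.injEq, true_and] at h
    obtain ⟨h1, h2⟩ := h
    have h3 := (snoc_inj h2).1
    have : i = j := by omega
    subst this; subst h3; rfl

noncomputable def glueEquiv (n : ℕ) :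
    ((Fin 3 × Pt n) ⊕ (Fin (2 * n) × Pt (n - 1))) ≃ Pt (n + 1) := by
  refine Equiv.ofBijective (fun x => ⟨glue n x, glue_mem n x⟩) ⟨?_, ?_⟩
  · intro x y h
    exact glue_inj n (congrArg Subtype.val h)
  · rintro ⟨W, hW⟩
    rcases P_cases n W hW with ⟨V, rfl, hV⟩ | ⟨V, rfl, hV⟩ | ⟨V, rfl, hV⟩ |
      ⟨k, V, l, m, rfl, rfl, hl, hm, hlm, hV⟩
    · exact ⟨Sum.inl (0, ⟨V, hV⟩), rfl⟩
    · exact ⟨Sum.inl (1, ⟨V, hV⟩), rfl⟩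
    · exact ⟨Sum.inl (2, ⟨V, hV⟩), rfl⟩
    · refine ⟨Sum.inr (⟨l - 2, by omega⟩, ⟨V, hV⟩), ?_⟩
      apply Subtype.ext
      simp only [glue]
      rw [show l - 2 + 2 = l by omega, show 2 * (k + 1) + 1 - (l - 2) = m by omega]

/-- The common counting sequence. -/
def zz : ℕ → ℕ
  | 0 => 1
  | 1 => 3
  | (n + 2) => 3 * zz (n + 1) + (2 * n + 2) * zz n

theorem zz_succ (n : ℕ) : zz (n + 1) = 3 * zz n + 2 * n * zz (n - 1) := by
  rcases n with _ | n
  · simp [zz]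
  · rw [zz, Nat.add_sub_cancel]; ring

theorem zz_pos (n : ℕ) : 0 < zz n := by
  induction n with
  | zero => simp [zz]
  | succ n ih => rw [zz_succ]; omega

theorem card_Pt (n : ℕ) : Nat.card (Pt n) = zz n := by
  induction n using Nat.strong_induction_on with
  | _ n ih =>
    rcases n with _ | n
    · have : Unique (Pt 0) := ⟨⟨⟨[], (P_zero []).2 rfl⟩⟩, fun x => Subtype.ext ((P_zero _).1 x.2)⟩
      simp [zz]
    · have h1 := ih n (by omega)
      have h2 := ih (n - 1) (by omega)
      have f1 : Finite (Pt n) := Nat.finite_of_card_ne_zero (by rw [h1]; exact (zz_pos _).ne')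
      have f2 : Finite (Pt (n - 1)) :=
        Nat.finite_of_card_ne_zero (by rw [h2]; exact (zz_pos _).ne')
      rw [← Nat.card_congr (glueEquiv n), Nat.card_sum, Nat.card_prod, Nat.card_prod, h1, h2,
        zz_succ]
      simp

end WD
namespace SC

/-- Clan conditions for an arbitrary type with a map `r`. -/
def IsClan {α : Type} (r : α → α) (p : (α → α) × (α → Bool)) : Prop :=
  (∀ i, p.1 (p.1 i) = i) ∧ (∀ i, p.1 i ≠ i → p.2 i = true) ∧
  (∀ i, p.1 (r i) = r (p.1 i)) ∧ (∀ i, p.1 i = i → p.2 (r i) = !(p.2 i))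

abbrev Clan {α : Type} (r : α → α) := {p : (α → α) × (α → Bool) // IsClan r p}

open Classical in
/-- Clans with prescribed values on an invariant set are clans on the complement. -/
noncomputable def fiberEquiv {α : Type} (r : α → α) (S : Set α) (hr : ∀ i, r i ∈ S ↔ i ∈ S)
    (t : α → α) (u : α → Bool) (h1 : ∀ i ∈ S, t i ∈ S) (h2 : ∀ i ∈ S, t (t i) = i)
    (h3 : ∀ i ∈ S, t i ≠ i → u i = true) (h4 : ∀ i ∈ S, t (r i) = r (t i))
    (h5 : ∀ i ∈ S, t i = i → u (r i) = !(u i)) :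
    {p : Clan r // ∀ i ∈ S, p.1.1 i = t i ∧ p.1.2 i = u i} ≃
      Clan (α := {x // x ∉ S}) (fun x => ⟨r x.1, fun h => x.2 ((hr _).1 h)⟩) where
  toFun p := ⟨(fun x => ⟨p.1.1.1 x.1, fun h => x.2 (by
      have := (p.2 _ h).1
      rw [p.1.2.1] at this
      rw [this]; exact h1 _ h)⟩, fun x => p.1.1.2 x.1), by
    obtain ⟨⟨⟨σ, s⟩, q1, q2, q3, q4⟩, q5⟩ := p
    refine ⟨fun i => ?_, fun i hi => ?_, fun i => ?_, fun i hi => ?_⟩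
    · exact Subtype.ext (q1 i.1)
    · exact q2 i.1 (fun h => hi (Subtype.ext h))
    · exact Subtype.ext (q3 i.1)
    · exact q4 i.1 (congrArg Subtype.val hi)⟩
  invFun p := ⟨⟨(fun x => if h : x ∈ S then t x else (p.1.1 ⟨x, h⟩).1,
      fun x => if h : x ∈ S then u x else p.1.2 ⟨x, h⟩), by
    obtain ⟨⟨σ, s⟩, q1, q2, q3, q4⟩ := p
    dsimp only at *
    refine ⟨fun i => ?_, fun i hi => ?_, fun i => ?_, fun i hi => ?_⟩ <;> dsimp only at *
    · by_cases h : i ∈ S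
      · simp [h, h1 i h, h2 i h]
      · have := (σ ⟨i, h⟩).2
        simp [h, this, q1]
    · by_cases h : i ∈ S
      · simp [h] at hi ⊢; exact h3 i h hi
      · simp [h] at hi ⊢; exact q2 ⟨i, h⟩ (fun h' => hi (congrArg Subtype.val h'))
    · by_cases h : i ∈ S
      · simp [h, hr, h4]
      · simp only [h, hr, dif_neg, not_false_eq_true]
        exact congrArg Subtype.val (q3 ⟨i, h⟩)
    · by_cases h : i ∈ S
      · simp [h, hr] at hi ⊢; exact h5 i h hi
      · simp [h, hr] at hi ⊢; exact q4 ⟨i, h⟩ (Subtype.ext hi)⟩, by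
    intro i hi
    simp [hi]⟩
  left_inv p := by
    obtain ⟨⟨⟨σ, s⟩, q⟩, q5⟩ := p
    replace q5 : ∀ i ∈ S, σ i = t i ∧ s i = u i := q5
    apply Subtype.ext; apply Subtype.ext
    refine Prod.ext (funext fun x => ?_) (funext fun x => ?_)
    · by_cases h : x ∈ S
      · simp [h, (q5 x h).1]
      · simp [h]
    · by_cases h : x ∈ S
      · simp [h, (q5 x h).2]
      · simp [h]
  right_inv p := by
    obtain ⟨⟨σ, s⟩, q⟩ := p
    apply Subtype.ext
    refine Prod.ext (funext fun x => ?_) (funext fun x => ?_)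
    · apply Subtype.ext
      simp [x.2]
    · simp [x.2]

theorem card_compl {α : Type} [Finite α] (S : Finset α) :
    Nat.card {x // x ∉ (S : Set α)} = Nat.card α - S.card := by
  classical
  have := Fintype.ofFinite α
  rw [Nat.card_eq_fintype_card, Nat.card_eq_fintype_card, ← Finset.card_compl,
    Fintype.card_subtype]
  congr 1
  ext x; simp

/-- counting statement, for induction -/
def Good (n : ℕ) : Prop := ∀ (α : Type) [Finite α] (r : α → α), (∀ i, r (r i) = i) →
  (∀ i, r i ≠ i) → Nat.card α = 2 * n → Nat.card (Clan r) = WD.zz n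

theorem good_fiber {m : ℕ} (hg : Good m) {α : Type} [Finite α] (r : α → α)
    (hr1 : ∀ i, r (r i) = i) (hr2 : ∀ i, r i ≠ i) (S : Finset α)
    (hc : Nat.card α = 2 * m + S.card) (hr : ∀ i ∈ S, r i ∈ S)
    (t : α → α) (u : α → Bool) (h1 : ∀ i ∈ S, t i ∈ S) (h2 : ∀ i ∈ S, t (t i) = i)
    (h3 : ∀ i ∈ S, t i ≠ i → u i = true) (h4 : ∀ i ∈ S, t (r i) = r (t i))
    (h5 : ∀ i ∈ S, t i = i → u (r i) = !(u i)) (P : Clan r → Prop)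
    (hP : ∀ p : Clan r, P p ↔ ∀ i ∈ S, p.1.1 i = t i ∧ p.1.2 i = u i) :
    Nat.card {p : Clan r // P p} = WD.zz m := by
  have e := fiberEquiv r (S : Set α)
    (fun i => ⟨fun h => by have := hr _ h; rwa [hr1] at this, fun h => hr _ h⟩) t u h1 h2 h3 h4 h5
  rw [Nat.card_congr (Equiv.subtypeEquivRight hP)]
  refine (Nat.card_congr e).trans ?_
  apply hg
  · intro i; exact Subtype.ext (hr1 i.1)
  · intro i h; exact hr2 i.1 (congrArg Subtype.val h)
  · rw [card_compl]; omega

theorem good_zero : Good 0 := by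
  intro α _ r _ _ hc
  have : IsEmpty α := by
    rw [mul_zero, Nat.card_eq_zero] at hc
    rcases hc with h | h
    · exact h
    · exact absurd ‹Finite α› (not_finite_iff_infinite.2 h)
  have : Unique (Clan r) := ⟨⟨⟨(id, fun _ => true), by
    refine ⟨?_, ?_, ?_, ?_⟩ <;> exact fun i => isEmptyElim i⟩⟩, fun x => Subsingleton.elim _ _⟩
  simp [WD.zz]

theorem good_succ (n : ℕ) (g1 : Good n) (g2 : Good (n - 1)) : Good (n + 1) := by
  classical
  intro α _ r hr1 hr2 hc
  have := Fintype.ofFinite α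
  have hne : Nonempty α := by
    rw [← Finite.card_pos_iff]; omega
  obtain ⟨a⟩ := hne
  have hra := hr2 a
  have hra' : a ≠ r a := fun h => hra h.symm
  let S2 : Finset α := {a, r a}
  have hS2 : S2.card = 2 := Finset.card_pair hra'
  -- fibre over signs
  have F1 : ∀ b, Nat.card {p : Clan r // (p.1.1 a, p.1.2 a) = (a, b)} = WD.zz n := by
    intro b
    refine good_fiber g1 r hr1 hr2 S2 (by omega) ?_ id (fun x => if x = a then b else !b)
      ?_ ?_ ?_ ?_ ?_ _ ?_
    · simp [S2, hr1]
    · simp [S2]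
    · simp
    · simp
    · simp
    · simp [S2, hr1, hra]
    · rintro ⟨⟨σ, s⟩, q1, q2, q3, q4⟩
      replace q1 : ∀ i, σ (σ i) = i := q1
      replace q2 : ∀ i, σ i ≠ i → s i = true := q2
      replace q3 : ∀ i, σ (r i) = r (σ i) := q3
      replace q4 : ∀ i, σ i = i → s (r i) = !(s i) := q4
      dsimp only
      constructor
      · intro h
        simp only [Prod.mk.injEq] at h
        obtain ⟨h, h'⟩ := h
        simp [S2, hra, q3, h, q4 a h, h']
      · intro h
        have := h a (by simp [S2])
        simpa using this
  have F2 : Nat.card {p : Clan r // (p.1.1 a, p.1.2 a) = (r a, true)} = WD.zz n := by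
    refine good_fiber g1 r hr1 hr2 S2 (by omega) ?_ r (fun x => true)
      ?_ ?_ ?_ ?_ ?_ _ ?_
    · simp [S2, hr1]
    · simp [S2, hr1]
    · simp [hr1]
    · simp
    · simp
    · intro i _ h; exact absurd h (hr2 i)
    · rintro ⟨⟨σ, s⟩, q1, q2, q3, q4⟩
      replace q1 : ∀ i, σ (σ i) = i := q1
      replace q2 : ∀ i, σ i ≠ i → s i = true := q2
      replace q3 : ∀ i, σ (r i) = r (σ i) := q3
      replace q4 : ∀ i, σ i = i → s (r i) = !(s i) := q4
      dsimp only
      constructor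
      · intro h
        simp only [Prod.mk.injEq] at h
        obtain ⟨h, h'⟩ := h
        have e1 : σ (r a) = a := by rw [q3, h, hr1]
        have e2 : s (r a) = true := q2 _ (by rw [e1]; exact hra')
        simp [S2, h, h', e1, e2, hr1]
      · intro h
        have := h a (by simp [S2])
        simpa using this
  have F3 : ∀ c, c ≠ a → c ≠ r a →
      Nat.card {p : Clan r // (p.1.1 a, p.1.2 a) = (c, true)} = WD.zz (n - 1) := by
    intro c hca hcra
    have hrc := hr2 c
    have n1 : r c ≠ a := fun h => hcra (by rw [← h, hr1])
    have n2 : r c ≠ r a := fun h => hca (by rw [← hr1 c, h, hr1])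
    let S4 : Finset α := {a, r a, c, r c}
    have hS4 : S4.card = 4 := by
      rw [Finset.card_insert_of_notMem, Finset.card_insert_of_notMem, Finset.card_pair hrc.symm] <;>
        simp [hca.symm, hcra.symm, n1.symm, n2.symm, hra.symm]
    have hn : 4 ≤ Nat.card α := by
      rw [← hS4, Nat.card_eq_fintype_card]; exact Finset.card_le_univ _
    refine good_fiber g2 r hr1 hr2 S4 (by omega) ?_
      (fun x => if x = a then c else if x = c then a else if x = r a then r c else r a)
      (fun x => true)
      ?_ ?_ ?_ ?_ ?_ _ ?_
    · simp [S4, hr1]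
    · simp [S4, hca, hcra, hra, n1, n2, hrc, hcra.symm]
    · simp [S4, hca, hcra, hra, n1, n2, hrc, hca.symm, hcra.symm, n1.symm, n2.symm]
    · simp
    · simp [S4, hca, hcra, hra, n1, n2, hrc, hr1, hca.symm, hcra.symm, n1.symm, n2.symm]
    · simp [S4, hca, hcra, hra, n1, n2, hrc, hr1, hca.symm, hcra.symm, n1.symm, n2.symm]
    · rintro ⟨⟨σ, s⟩, q1, q2, q3, q4⟩
      replace q1 : ∀ i, σ (σ i) = i := q1
      replace q2 : ∀ i, σ i ≠ i → s i = true := q2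
      replace q3 : ∀ i, σ (r i) = r (σ i) := q3
      replace q4 : ∀ i, σ i = i → s (r i) = !(s i) := q4
      dsimp only
      constructor
      · intro h
        simp only [Prod.mk.injEq] at h
        obtain ⟨h, h'⟩ := h
        have e0 : σ c = a := by rw [← h, q1]
        have e1 : σ (r a) = r c := by rw [q3, h]
        have e2 : σ (r c) = r a := by rw [q3, e0]
        have e3 : s c = true := q2 _ (by rw [e0]; exact hca.symm)
        have e4 : s (r a) = true := q2 _ (by rw [e1]; exact n2)
        have e5 : s (r c) = true := q2 _ (by rw [e2]; exact n2.symm)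
        simp [S4, h, h', e0, e1, e2, e3, e4, e5, hca, hra, hcra.symm, n1, n2, hrc]
      · intro h
        have := h a (by simp [S4])
        simpa using this
  have F4 : ∀ c, c ≠ a → Nat.card {p : Clan r // (p.1.1 a, p.1.2 a) = (c, false)} = 0 := by
    intro c hc
    have : IsEmpty {p : Clan r // (p.1.1 a, p.1.2 a) = (c, false)} := by
      constructor
      rintro ⟨⟨⟨σ, s⟩, q1, q2, q3, q4⟩, h⟩
      simp only [Prod.mk.injEq] at h
      have := q2 a (by dsimp only; rw [h.1]; exact hc)
      simp [h.2] at this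
    exact Nat.card_of_isEmpty
  rw [← Nat.card_congr (Equiv.sigmaFiberEquiv (fun p : Clan r => (p.1.1 a, p.1.2 a))),
    Nat.card_sigma, Fintype.sum_prod_type]
  have key : ∀ c : α, ∑ b : Bool, Nat.card {p : Clan r // (p.1.1 a, p.1.2 a) = (c, b)} =
      if c ∈ S2 then (if c = a then 2 * WD.zz n else WD.zz n) else WD.zz (n - 1) := by
    intro c
    rw [Fintype.sum_bool]
    by_cases h : c = a
    · subst h; rw [F1, F1]; simp [S2]; ring
    · rw [F4 c h]
      by_cases h' : c = r a
      · subst h'; rw [F2]; simp [S2, hra]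
      · rw [F3 c h h']; simp [S2, h, h']
  rw [Finset.sum_congr rfl (fun c _ => key c), ← Finset.sum_add_sum_compl S2]
  have s1 : ∑ c ∈ S2, (if c ∈ S2 then (if c = a then 2 * WD.zz n else WD.zz n)
      else WD.zz (n - 1)) = 3 * WD.zz n := by
    rw [Finset.sum_pair hra']; simp [S2, hra]; ring
  have s2 : ∑ c ∈ S2ᶜ, (if c ∈ S2 then (if c = a then 2 * WD.zz n else WD.zz n)
      else WD.zz (n - 1)) = 2 * n * WD.zz (n - 1) := by
    rw [Finset.sum_congr rfl (g := fun _ => WD.zz (n - 1))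
      (fun c hc => by rw [if_neg (Finset.mem_compl.1 hc)])]
    rw [Finset.sum_const, Finset.card_compl, hS2, ← Nat.card_eq_fintype_card, hc, smul_eq_mul]
    congr 1
  rw [s1, s2, WD.zz_succ]

theorem good (n : ℕ) : Good n := by
  induction n using Nat.strong_induction_on with
  | _ n ih =>
    rcases n with _ | n
    · exact good_zero
    · exact good_succ n (ih n (by omega)) (ih (n - 1) (by omega))

theorem balance {n : ℕ} (σ : Fin (2 * n) → Fin (2 * n)) (s : Fin (2 * n) → Bool)
    (q3 : ∀ i, σ (Fin.rev i) = Fin.rev (σ i)) (q4 : ∀ i, σ i = i → s (Fin.rev i) = !(s i)) :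
    (Finset.univ.filter (fun i => σ i = i ∧ s i = true)).card =
      (Finset.univ.filter (fun i => σ i = i ∧ s i = false)).card := by
  apply Finset.card_bij (fun i _ => Fin.rev i)
  · intro i hi
    simp only [Finset.mem_filter, Finset.mem_univ, true_and] at hi ⊢
    rw [q3, hi.1, q4 i hi.1, hi.2]; simp
  · intro i _ j _ h
    exact Fin.rev_injective h
  · intro i hi
    simp only [Finset.mem_filter, Finset.mem_univ, true_and] at hi
    refine ⟨Fin.rev i, ?_, by simp⟩
    simp only [Finset.mem_filter, Finset.mem_univ, true_and]
    rw [q3, hi.1, q4 i hi.1, hi.2]; simp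

def clanEquiv (n : ℕ) :
    {p : Equiv.Perm (Fin (2 * n)) × (Fin (2 * n) → Bool) // IsSkewClan n p.1 p.2} ≃
      Clan (Fin.rev : Fin (2 * n) → Fin (2 * n)) where
  toFun p := ⟨(p.1.1, p.1.2), p.2.1, p.2.2.1, p.2.2.2.2.1, p.2.2.2.2.2⟩
  invFun p := ⟨(Function.Involutive.toPerm p.1.1 p.2.1, p.1.2), by
    exact ⟨p.2.1, p.2.2.1, balance p.1.1 p.1.2 p.2.2.2.1 p.2.2.2.2, p.2.2.2.1, p.2.2.2.2⟩⟩
  left_inv p := by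
    apply Subtype.ext
    refine Prod.ext (Equiv.ext fun x => rfl) rfl
  right_inv p := rfl

theorem card_skew (n : ℕ) : Znum n = WD.zz n := by
  unfold Znum
  rw [Nat.card_congr (clanEquiv n)]
  apply good n
  · intro i; simp
  · intro i h
    have := congrArg Fin.val h
    rw [Fin.val_rev] at this
    omega
  · simp

end SC

/-- there is a bijection between the set `ℒ^w(n,n)` of weighted `(n,n)`
Delannoy paths and the set of skew-symmetric `(n,n)`-clans; in particular
`|ℒ^w(n,n)| = Z_n`. -/
theorem stmt9 (n : ℕ) :
    Nonempty
      ({W : List (Fin 3 × ℕ) // IsWeightedDelannoy n W} ≃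
       {p : Equiv.Perm (Fin (2 * n)) × (Fin (2 * n) → Bool) // IsSkewClan n p.1 p.2}) ∧
    Nat.card {W : List (Fin 3 × ℕ) // IsWeightedDelannoy n W} = Znum n := by
  have h1 := WD.card_Pt n
  have h2 := SC.card_skew n
  have e : Nat.card {W : List (Fin 3 × ℕ) // IsWeightedDelannoy n W} = Znum n := h1.trans h2.symm
  refine ⟨?_, e⟩
  have hz : WD.zz n ≠ 0 := (WD.zz_pos n).ne'
  have e1 := Nat.equivFinOfCardPos (h1.symm ▸ hz :
    Nat.card {W : List (Fin 3 × ℕ) // IsWeightedDelannoy n W} ≠ 0)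
  have e2 := Nat.equivFinOfCardPos (h2.symm ▸ hz : Znum n ≠ 0)
  exact ⟨e1.trans ((finCongr e).trans e2.symm)⟩
end
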